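/- arXiv:1409.8058 — 3 statements merged into one kernel-verified Lean document; each statement's English description precedes it below -/
import Mathlib

section
/- Let X be a Banach space and let A : D(A) → X be the generator of a C₀-semigroup (T(t))_{t≥0} on X. Let X̄ be a Banach space such that X ⊆ X̄ is dense with continuous inclusion, and suppose an operator Ā generates a C₀-semigroup (T̄(t))_{t≥0} on X̄ with T̄(t)|_X = T(t) for all t ≥ 0 and with domain D(Ā) = X. Let B : X → X̄ be a bounded linear operator and assume there exists t₀ > 0 such that (i) ∫₀^{t₀} T̄(t₀−t) B f(t) dt ∈ X for every f ∈ C([0,t₀],X), and (ii) there exists K ∈ (0,1) such that ‖∫₀^{t₀} T̄(t₀−t) B f(t) dt‖ ≤ K · sup_{t∈[0,t₀]} ‖f(t)‖ for every f ∈ C([0,t₀],X). Then the operator C x = Ā x + B x with domain D(C) = {x ∈ X : Ā x + B x ∈ X} generates a C₀-semigroup on X. -/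
open Filter Topology Set MeasureTheory

namespace DS

section SemigroupDefs

variable {E : Type*} [AddCommGroup E] [Module ℝ E] [TopologicalSpace E]

/-- `I` is the Riemann integral of `g` over `[a,b]`, defined as the limit of the left Riemann
sums over uniform partitions. -/
def IsRiemannIntegral (g : ℝ → E) (a b : ℝ) (I : E) : Prop :=
  Tendsto
    (fun n : ℕ => ((b - a) / (n : ℝ)) •
      ∑ k ∈ Finset.range n, g (a + (b - a) * (k : ℝ) / (n : ℝ)))
    atTop (𝓝 I)

/-- `(T t)_{t ≥ 0}` is a `C₀`-semigroup. -/
def IsC0Semigroup (T : ℝ → E →L[ℝ] E) : Prop :=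
  T 0 = ContinuousLinearMap.id ℝ E ∧
    (∀ t s : ℝ, 0 ≤ t → 0 ≤ s → T (t + s) = (T t).comp (T s)) ∧
    ∀ x : E, ContinuousOn (fun t : ℝ => T t x) (Ici (0 : ℝ))

/-- Local equicontinuity of a one-parameter family of operators. -/
def IsLocallyEquicontinuous (T : ℝ → E →L[ℝ] E) : Prop :=
  ∀ t₀ : ℝ, 0 < t₀ → ∀ p : Seminorm ℝ E, Continuous (fun x : E => p x) →
    ∃ q : Seminorm ℝ E, Continuous (fun x : E => q x) ∧
      ∃ M : ℝ, 0 ≤ M ∧ ∀ x : E, ∀ t ∈ Icc (0 : ℝ) t₀, p (T t x) ≤ M * q x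

/-- `A`, with domain `domA`, is the infinitesimal generator of the semigroup `T`. -/
def IsGenerator (T : ℝ → E →L[ℝ] E) (domA : Set E) (A : E → E) : Prop :=
  (∀ x : E, x ∈ domA ↔
      ∃ y : E, Tendsto (fun t : ℝ => t⁻¹ • (T t x - x)) (𝓝[>] 0) (𝓝 y)) ∧
    ∀ x ∈ domA, Tendsto (fun t : ℝ => t⁻¹ • (T t x - x)) (𝓝[>] 0) (𝓝 (A x))

/-- Derivative of a vector-valued function within a set, in a topological vector space. -/
def HasDerivWithinAtLC (f : ℝ → E) (y : E) (s : Set ℝ) (t : ℝ) : Prop :=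
  Tendsto (fun u : ℝ => (u - t)⁻¹ • (f u - f t)) (𝓝[s \ {t}] t) (𝓝 y)

/-- Membership in `𝒳 = { f ∈ C([0,t₀],E) : f 0 = 0 }`; functions are given on all of `ℝ`,
but only their restriction to `[0,t₀]` is relevant. -/
def MemXc (t₀ : ℝ) (f : ℝ → E) : Prop :=
  ContinuousOn f (Icc (0 : ℝ) t₀) ∧ f 0 = 0

/-- `f ∈ D(𝒟)` with `𝒟 f = f'`. -/
def MemDD (t₀ : ℝ) (f f' : ℝ → E) : Prop :=
  MemXc t₀ f ∧ (∀ t ∈ Icc (0 : ℝ) t₀, HasDerivWithinAtLC f (f' t) (Icc (0 : ℝ) t₀) t) ∧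
    ContinuousOn f' (Icc (0 : ℝ) t₀) ∧ f' 0 = 0

/-- `f ∈ D(𝒜)` for the operator `𝒜` induced on `𝒳` by `A` with domain `domA`. -/
def MemDA (t₀ : ℝ) (domA : Set E) (A : E → E) (f : ℝ → E) : Prop :=
  MemXc t₀ f ∧ (∀ t ∈ Icc (0 : ℝ) t₀, f t ∈ domA) ∧
    ContinuousOn (fun t : ℝ => A (f t)) (Icc (0 : ℝ) t₀)

end SemigroupDefs

/-- Sequential completeness of a uniform space. -/
def SeqComplete (E : Type*) [UniformSpace E] : Prop :=
  ∀ u : ℕ → E, CauchySeq u → ∃ x : E, Tendsto u atTop (𝓝 x)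

end DS

open DS

theorem DSaux.hasDeriv_right {F : Type*} [NormedAddCommGroup F] [NormedSpace ℝ F]
    {f : ℝ → F} {y : F} {x : ℝ} :
    HasDerivWithinAt f y (Ioi x) x ↔
      Tendsto (fun h : ℝ => h⁻¹ • (f (x + h) - f x)) (𝓝[>] 0) (𝓝 y) := by
  rw [hasDerivWithinAt_iff_tendsto_slope' (by simp)]
  have h1 : 𝓝[>] x = map (fun h => x + h) (𝓝[>] (0 : ℝ)) := by
    rw [map_add_left_nhdsGT]; simp
  rw [h1, tendsto_map'_iff]
  refine tendsto_congr fun h => ?_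
  simp [slope_def_module]

theorem DSaux.hasDeriv_right_integral {F : Type*} [NormedAddCommGroup F] [NormedSpace ℝ F]
    [CompleteSpace F] {f : ℝ → F} (hf : Continuous f) (a x : ℝ) :
    Tendsto (fun h : ℝ => h⁻¹ • (∫ s in x..(x+h), f s)) (𝓝[>] 0) (𝓝 (f x)) := by
  have := DSaux.hasDeriv_right.1
    ((hf.integral_hasStrictDerivAt a x).hasDerivAt.hasDerivWithinAt (s := Ioi x))
  refine this.congr fun h => ?_
  rw [intervalIntegral.integral_interval_sub_left] <;> exact hf.intervalIntegrable _ _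

/-- Strong continuity from local data. -/
theorem DSaux.c0_of_local {X : Type*} [NormedAddCommGroup X] [NormedSpace ℝ X]
    (t₀ : ℝ) (ht₀ : 0 < t₀) (S₀ : ℝ → X →L[ℝ] X) (h0 : S₀ 0 = ContinuousLinearMap.id ℝ X)
    (hadd : ∀ t s : ℝ, 0 ≤ t → 0 ≤ s → t + s ≤ t₀ → S₀ (t + s) = (S₀ t).comp (S₀ s))
    (hcont : ∀ x, Continuous (fun t => S₀ t x))
    (hbd : ∃ M, ∀ t ∈ Icc 0 t₀, ‖S₀ t‖ ≤ M) :
    ∃ S : ℝ → X →L[ℝ] X, IsC0Semigroup S ∧ ∀ t ∈ Ico 0 t₀, S t = S₀ t := by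
  obtain ⟨M, hM⟩ := hbd
  let r : ℝ → ℝ := fun t => Int.fract (t / t₀) * t₀
  have hr0 : ∀ t, 0 ≤ r t := fun t => mul_nonneg (Int.fract_nonneg _) ht₀.le
  have hr1 : ∀ t, r t < t₀ := fun t => by
    have := Int.fract_lt_one (t / t₀)
    simp only [r]; nlinarith
  let S : ℝ → X →L[ℝ] X := fun t => S₀ t₀ ^ ⌊t / t₀⌋₊ * S₀ (r t)
  have hmul : ∀ t s : ℝ, 0 ≤ t → 0 ≤ s → t + s ≤ t₀ → S₀ (t + s) = S₀ t * S₀ s := hadd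
  have hcomm : ∀ a, 0 ≤ a → a ≤ t₀ → Commute (S₀ a) (S₀ t₀) := by
    intro a ha ha'
    have e1 : S₀ t₀ = S₀ (t₀ - a) * S₀ a := by
      rw [← hmul _ _ (by linarith) ha (by linarith)]; congr 1; ring
    have e2 : S₀ t₀ = S₀ a * S₀ (t₀ - a) := by
      rw [← hmul _ _ ha (by linarith) (by linarith)]; congr 1; ring
    show S₀ a * S₀ t₀ = S₀ t₀ * S₀ a
    conv_lhs => rw [e1]
    rw [← mul_assoc, ← e2]
  have hadd' : ∀ t s : ℝ, 0 ≤ t → 0 ≤ s → S (t + s) = S t * S s := by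
    intro t s ht hs
    have ht' : 0 ≤ t / t₀ := by positivity
    have hs' : 0 ≤ s / t₀ := by positivity
    have key : ∀ u : ℝ, 0 ≤ u → u / t₀ = (⌊u / t₀⌋₊ : ℝ) + r u / t₀ := by
      intro u hu
      have : (⌊u / t₀⌋₊ : ℝ) = (⌊u / t₀⌋ : ℝ) := by
        rw [natCast_floor_eq_intCast_floor (by positivity)]
      rw [this]; simp only [r]
      rw [mul_div_cancel_right₀ _ ht₀.ne', Int.floor_add_fract]
    have uniq : ∀ (u : ℝ) (n : ℕ) (q : ℝ), 0 ≤ q → q < t₀ → u = n * t₀ + q →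
        S u = S₀ t₀ ^ n * S₀ q := by
      intro u n q hq hq' hu
      have e1 : u / t₀ = q / t₀ + n := by rw [hu]; field_simp; ring
      have e3 : q / t₀ < 1 := by rw [div_lt_one ht₀]; exact hq'
      have e4 : 0 ≤ q / t₀ := by positivity
      have e2 : ⌊u / t₀⌋₊ = n := by
        rw [e1, Nat.floor_add_natCast e4, Nat.floor_eq_zero.2 e3]; simp
      have e5 : r u = q := by
        simp only [r]
        rw [e1, Int.fract_add_natCast, Int.fract_eq_self.2 ⟨e4, e3⟩]; field_simp
      simp only [S]; rw [e2, e5]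
    have kt := key t ht
    have ks := key s hs
    have kt' : t = ⌊t / t₀⌋₊ * t₀ + r t := by field_simp at kt; linarith
    have ks' : s = ⌊s / t₀⌋₊ * t₀ + r s := by field_simp at ks; linarith
    have hprod : S t * S s = S₀ t₀ ^ (⌊t / t₀⌋₊ + ⌊s / t₀⌋₊) * (S₀ (r t) * S₀ (r s)) := by
      simp only [S]
      have := ((hcomm (r t) (hr0 t) (hr1 t).le).pow_right ⌊s / t₀⌋₊).eq
      rw [pow_add, mul_assoc, ← mul_assoc (S₀ (r t)), this]
      simp only [mul_assoc]
    rw [hprod]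
    by_cases hlt : r t + r s < t₀
    · rw [uniq (t + s) (⌊t / t₀⌋₊ + ⌊s / t₀⌋₊) (r t + r s) (add_nonneg (hr0 t) (hr0 s)) hlt
        (by push_cast; linarith), hmul _ _ (hr0 t) (hr0 s) hlt.le]
    · push Not at hlt
      have h1 := hr1 t
      have h2 := hr1 s
      have h3 := hr0 t
      rw [uniq (t + s) (⌊t / t₀⌋₊ + ⌊s / t₀⌋₊ + 1) (r t + r s - t₀) (by linarith) (by linarith)
        (by push_cast; linarith), pow_succ, mul_assoc]
      congr 1
      have e1 : S₀ (r s) = S₀ (t₀ - r t) * S₀ (r t + r s - t₀) := by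
        rw [← hmul _ _ (by linarith) (by linarith) (by linarith)]; congr 1; ring
      have e2 : S₀ t₀ = S₀ (r t) * S₀ (t₀ - r t) := by
        rw [← hmul _ _ (by linarith) (by linarith) (by linarith)]; congr 1; ring
      rw [e1, e2, mul_assoc]
  have hloc : ∀ t ∈ Ico 0 t₀, S t = S₀ t := by
    intro t ht
    have e3 : t / t₀ < 1 := by rw [div_lt_one ht₀]; exact ht.2
    have e4 : 0 ≤ t / t₀ := div_nonneg ht.1 ht₀.le
    simp only [S, r]
    rw [Nat.floor_eq_zero.2 e3, Int.fract_eq_self.2 ⟨e4, e3⟩, div_mul_cancel₀ _ ht₀.ne']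
    simp
  have hS0 : S 0 = ContinuousLinearMap.id ℝ X := by rw [hloc 0 ⟨le_rfl, ht₀⟩, h0]
  have hM0 : 0 ≤ M := (norm_nonneg _).trans (hM 0 ⟨le_rfl, ht₀.le⟩)
  have hSb : ∀ t, ‖S t‖ ≤ (max M 1) ^ (⌊t / t₀⌋₊ + 1) := by
    intro t
    have hn : ∀ n : ℕ, ‖S₀ t₀ ^ n‖ ≤ (max M 1) ^ n := by
      intro n
      induction n with
      | zero =>
        simp only [pow_zero]; exact ContinuousLinearMap.norm_id_le
      | succ n ih =>
        rw [pow_succ, pow_succ]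
        refine (norm_mul_le _ _).trans ?_
        gcongr
        exact (hM t₀ ⟨ht₀.le, le_rfl⟩).trans (le_max_left _ _)
    rw [pow_succ]
    refine (norm_mul_le _ _).trans ?_
    gcongr
    · exact hn _
    · exact (hM _ ⟨hr0 t, (hr1 t).le⟩).trans (le_max_left _ _)
  have hSb' : ∀ t u, t ≤ u → ‖S t‖ ≤ (max M 1) ^ (⌊u / t₀⌋₊ + 1) := by
    intro t u htu
    refine (hSb t).trans (pow_le_pow_right₀ (le_max_right _ _) ?_)
    gcongr
  refine ⟨S, ⟨hS0, hadd', ?_⟩, hloc⟩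
  intro x t ht
  have ht : 0 ≤ t := ht
  rw [Metric.continuousWithinAt_iff]
  intro ε hε
  set N := (max M 1) ^ (⌊(t + 1) / t₀⌋₊ + 1) with hN
  have hNpos : 0 < N := by positivity
  have hc := (hcont x).continuousAt (x := 0)
  rw [Metric.continuousAt_iff] at hc
  obtain ⟨δ, hδ, hδ'⟩ := hc (ε / N) (by positivity)
  refine ⟨min δ (min t₀ 1), by positivity, ?_⟩
  have main : ∀ a b, 0 ≤ a → a ≤ b → a ≤ t + 1 → b - a < min δ (min t₀ 1) →
      dist (S b x) (S a x) < ε := by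
    intro a b ha hab hat hba
    have e1 : S b = S a * S (b - a) := by rw [← hadd' _ _ ha (by linarith)]; congr 1; ring
    have h1 : b - a < δ := hba.trans_le (min_le_left _ _)
    have h2 : b - a < t₀ := hba.trans_le ((min_le_right _ _).trans (min_le_left _ _))
    have h3 := @hδ' (b - a) (by rw [Real.dist_eq, sub_zero, abs_of_nonneg (by linarith)]; exact h1)
    rw [h0, ← hloc (b - a) ⟨by linarith, h2⟩] at h3
    rw [e1, dist_eq_norm]
    have : (S a * S (b - a)) x - S a x = S a (S (b - a) x - x) := by simp
    rw [this]
    rw [dist_eq_norm] at h3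
    calc _ ≤ ‖S a‖ * ‖S (b - a) x - x‖ := (S a).le_opNorm _
      _ ≤ N * ‖S (b - a) x - x‖ := by gcongr; exact hSb' _ _ hat
      _ < N * (ε / N) := by gcongr; exact h3
      _ = ε := by field_simp
  intro s hs hst
  have hs : 0 ≤ s := hs
  rw [Real.dist_eq] at hst
  have h4 : min δ (min t₀ 1) ≤ 1 := (min_le_right _ _).trans (min_le_right _ _)
  rcases le_total t s with h | h
  · rw [abs_of_nonneg (by linarith)] at hst
    exact main t s ht h (by linarith) hst
  · rw [abs_of_nonpos (by linarith)] at hst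
    rw [dist_comm]
    exact main s t hs h (by linarith) (by linarith)

theorem DSaux.stage3 {X Y : Type*} [NormedAddCommGroup X] [NormedSpace ℝ X] [CompleteSpace X]
    [NormedAddCommGroup Y] [NormedSpace ℝ Y] [CompleteSpace Y]
    (e D : X →L[ℝ] Y)
    (t₀ : ℝ) (ht₀ : 0 < t₀) (S₀ : ℝ → X →L[ℝ] X)
    (hcont : ∀ x, Continuous (fun t => S₀ t x))
    (hbd : ∃ M, ∀ t ∈ Icc 0 t₀, ‖S₀ t‖ ≤ M)
    (h0 : S₀ 0 = ContinuousLinearMap.id ℝ X)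
    (hsol : ∀ x, ∀ t ∈ Icc 0 t₀, e (S₀ t x) = e x + ∫ s in (0:ℝ)..t, D (S₀ s x))
    (huniq : ∀ τ, 0 ≤ τ → τ ≤ t₀ → ∀ w : ℝ → X, Continuous w → w 0 = 0 →
      (∀ t ∈ Icc 0 τ, e (w t) = ∫ s in (0:ℝ)..t, D (w s)) → ∀ t ∈ Icc 0 τ, w t = 0) :
    ∃ S : ℝ → X →L[ℝ] X, IsC0Semigroup S ∧
      ∀ x y, (e y = D x ↔ Tendsto (fun t : ℝ => t⁻¹ • (S t x - x)) (𝓝[>] 0) (𝓝 y)) := by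
  have hDc : ∀ x, Continuous (fun s => D (S₀ s x)) := fun x => D.continuous.comp (hcont x)
  have hadd : ∀ t s : ℝ, 0 ≤ t → 0 ≤ s → t + s ≤ t₀ → S₀ (t + s) = (S₀ t).comp (S₀ s) := by
    intro t s ht hs hts
    ext x
    have hc1 : Continuous (fun r => S₀ (r + s) x) := (hcont x).comp (by fun_prop)
    have hc2 : Continuous (fun r => S₀ r (S₀ s x)) := hcont _
    have hc1' : Continuous (fun r => D (S₀ (r + s) x)) := D.continuous.comp hc1
    have := huniq t ht (by linarith) (fun r => S₀ (r + s) x - S₀ r (S₀ s x))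
      (hc1.sub hc2) (by simp [h0]) ?_ t ⟨ht, le_rfl⟩
    · simpa [sub_eq_zero] using this
    intro r hr
    simp only [map_sub]
    rw [hsol x (r + s) ⟨by linarith [hr.1], by linarith [hr.2]⟩,
      hsol _ r ⟨hr.1, by linarith [hr.2]⟩, hsol x s ⟨hs, by linarith⟩,
      intervalIntegral.integral_sub (hc1'.intervalIntegrable _ _)
      ((hDc (S₀ s x)).intervalIntegrable _ _),
      intervalIntegral.integral_comp_add_right (fun r => D (S₀ r x)) s,
      zero_add, ← intervalIntegral.integral_add_adjacent_intervals
        ((hDc x).intervalIntegrable 0 s) ((hDc x).intervalIntegrable s (r + s))]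
    abel
  obtain ⟨S, hS, hloc⟩ := DSaux.c0_of_local t₀ ht₀ S₀ h0 hadd hcont hbd
  refine ⟨S, hS, fun x y => ?_⟩
  have hev : ∀ᶠ t in 𝓝[>] (0:ℝ), S t = S₀ t ∧ t ∈ Icc 0 t₀ := by
    filter_upwards [Ioo_mem_nhdsGT ht₀] with t ht
    exact ⟨hloc t ⟨ht.1.le, ht.2⟩, ht.1.le, ht.2.le⟩
  constructor
  · intro hxy
    have hIc : Continuous (fun t => ∫ s in (0:ℝ)..t, S₀ s y) :=
      intervalIntegral.continuous_primitive (fun a b => (hcont y).intervalIntegrable a b) 0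
    have hz := huniq t₀ ht₀.le le_rfl (fun t => x + (∫ s in (0:ℝ)..t, S₀ s y) - S₀ t x)
      ((continuous_const.add hIc).sub (hcont x)) (by simp [h0]) ?_
    · have h1 := DSaux.hasDeriv_right_integral (hcont y) 0 0
      rw [h0] at h1
      refine h1.congr' ?_
      filter_upwards [hev] with t ht
      have := hz t ht.2
      rw [ht.1, zero_add]
      rw [sub_eq_zero] at this
      rw [← this]
      simp
    · have key : ∀ t ∈ Icc 0 t₀, D (x + ∫ s in (0:ℝ)..t, S₀ s y) = e (S₀ t y) := by
        intro t ht
        rw [map_add, ← D.intervalIntegral_comp_comm ((hcont y).intervalIntegrable _ _),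
          hsol y t ht, hxy]
      intro t ht
      have hc1 : Continuous (fun s => D (x + ∫ r in (0:ℝ)..s, S₀ r y)) :=
        D.continuous.comp (continuous_const.add hIc)
      have h2 : ∫ s in (0:ℝ)..t, D (x + ∫ r in (0:ℝ)..s, S₀ r y) =
          ∫ s in (0:ℝ)..t, e (S₀ s y) := by
        refine intervalIntegral.integral_congr fun s hs => ?_
        rw [uIcc_of_le ht.1] at hs
        exact key s ⟨hs.1, hs.2.trans ht.2⟩
      simp only [map_sub]
      rw [intervalIntegral.integral_sub (hc1.intervalIntegrable _ _)
        ((hDc x).intervalIntegrable _ _), h2, hsol x t ht,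
        e.intervalIntegral_comp_comm ((hcont y).intervalIntegrable _ _), map_add]
      abel
  · intro hlim
    have h1 : Tendsto (fun t : ℝ => e (t⁻¹ • (S t x - x))) (𝓝[>] 0) (𝓝 (e y)) :=
      (e.continuous.tendsto y).comp hlim
    have h2 := DSaux.hasDeriv_right_integral (hDc x) 0 0
    rw [h0] at h2
    refine tendsto_nhds_unique h1 (h2.congr' ?_)
    filter_upwards [hev] with t ht
    rw [map_smul, map_sub, ht.1, hsol x t ht.2]
    simp

theorem DSaux.joint_cont {Y : Type*} [NormedAddCommGroup Y] [NormedSpace ℝ Y] [CompleteSpace Y]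
    (Tb : ℝ → Y →L[ℝ] Y) (hTb : IsC0Semigroup Tb) :
    Continuous (fun p : ℝ × Y => Tb (max p.1 0) p.2) := by
  have hc : ∀ y, Continuous (fun t => Tb (max t 0) y) := fun y =>
    (hTb.2.2 y).comp_continuous (by fun_prop) (fun t => mem_Ici.2 (le_max_right _ _))
  rw [continuous_iff_continuousAt]
  rintro ⟨t, y⟩
  have hb : ∃ M, ∀ s : Icc (t - 1) (t + 1), ‖Tb (max (s : ℝ) 0)‖ ≤ M := by
    refine banach_steinhaus fun z => ?_
    obtain ⟨C, hC⟩ := (isCompact_Icc (a := t - 1) (b := t + 1)).exists_bound_of_continuousOn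
      (hc z).continuousOn
    exact ⟨C, fun s => hC s s.2⟩
  obtain ⟨M, hM⟩ := hb
  have h1 : ContinuousOn (fun p : ℝ × Y => Tb (max p.1 0) p.2)
      (Icc (t - 1) (t + 1) ×ˢ (univ : Set Y)) := by
    refine continuousOn_prod_of_continuousOn_lipschitzOnWith' _ M.toNNReal ?_ ?_
    · intro a ha
      refine LipschitzWith.lipschitzOnWith (LipschitzWith.of_dist_le_mul fun y z => ?_)
      rw [dist_eq_norm, dist_eq_norm]
      simp only
      rw [← map_sub]
      refine (ContinuousLinearMap.le_opNorm _ _).trans ?_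
      gcongr
      exact (hM ⟨a, ha⟩).trans (Real.le_coe_toNNReal M)
    · intro z _
      exact (hc z).continuousOn
  exact h1.continuousAt (prod_mem_nhds (Icc_mem_nhds (by linarith) (by linarith)) univ_mem)

theorem DSaux.avg {Y : Type*} [NormedAddCommGroup Y] [NormedSpace ℝ Y] [CompleteSpace Y]
    (F : ℝ → ℝ → Y) (hF : Continuous (Function.uncurry F)) (t : ℝ) :
    Tendsto (fun h : ℝ => h⁻¹ • ∫ s in t..(t + h), F h s) (𝓝[>] 0) (𝓝 (F 0 t)) := by
  have h1 : Continuous (fun h : ℝ => ∫ θ in (0:ℝ)..1, F h (t + h * θ)) := by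
    refine intervalIntegral.continuous_parametric_intervalIntegral_of_continuous ?_
      continuous_const
    exact hF.comp (f := fun p : ℝ × ℝ => (p.1, t + p.1 * p.2)) (by fun_prop)
  have h2 := (h1.tendsto 0).mono_left (nhdsWithin_le_nhds (s := Ioi 0))
  simp only [zero_mul, add_zero, intervalIntegral.integral_const, sub_zero, one_smul] at h2
  refine h2.congr' ?_
  filter_upwards [self_mem_nhdsWithin] with h hh
  have hh : 0 < h := hh
  have := intervalIntegral.smul_integral_comp_add_mul (a := 0) (b := 1) (F h) h t
  simp only [mul_zero, add_zero, mul_one] at this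
  rw [← this, smul_smul, inv_mul_cancel₀ hh.ne', one_smul]

section
variable {Y : Type*} [NormedAddCommGroup Y] [NormedSpace ℝ Y] [CompleteSpace Y]
  {P : ℝ → Y →L[ℝ] Y}

theorem DSaux.orbit (hP : Continuous (fun p : ℝ × Y => P p.1 p.2))
    (hP0 : ∀ y, P 0 y = y)
    (hPadd : ∀ t s, 0 ≤ t → 0 ≤ s → ∀ y, P (t + s) y = P t (P s y))
    {v z : Y} (h : Tendsto (fun h : ℝ => h⁻¹ • (P h v - v)) (𝓝[>] 0) (𝓝 z))
    {t : ℝ} (ht : 0 ≤ t) : P t v = v + ∫ s in (0:ℝ)..t, P s z := by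
  have hc : ∀ y, Continuous (fun t => P t y) := fun y => hP.comp (f := fun t => (t, y)) (by fun_prop)
  have := intervalIntegral.integral_eq_sub_of_hasDeriv_right_of_le (f := fun s => P s v)
    (f' := fun s => P s z) ht (hc v).continuousOn ?_ ((hc z).intervalIntegrable _ _)
  · rw [this, hP0]; abel
  intro s hs
  rw [DSaux.hasDeriv_right]
  refine (((P s).continuous.tendsto z).comp h).congr' ?_
  filter_upwards [self_mem_nhdsWithin] with r hr
  have hr : 0 < r := hr
  simp [hPadd s r hs.1.le hr.le]

theorem DSaux.integral_mem (hP : Continuous (fun p : ℝ × Y => P p.1 p.2))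
    (hP0 : ∀ y, P 0 y = y)
    (hPadd : ∀ t s, 0 ≤ t → 0 ≤ s → ∀ y, P (t + s) y = P t (P s y))
    (y : Y) {t : ℝ} (ht : 0 ≤ t) :
    Tendsto (fun h : ℝ => h⁻¹ • (P h (∫ s in (0:ℝ)..t, P s y) - ∫ s in (0:ℝ)..t, P s y))
      (𝓝[>] 0) (𝓝 (P t y - y)) := by
  have hc : ∀ y, Continuous (fun t => P t y) := fun y => hP.comp (f := fun t => (t, y)) (by fun_prop)
  have hi : ∀ a b, IntervalIntegrable (fun t => P t y) volume a b :=
    fun a b => (hc y).intervalIntegrable a b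
  have h1 := DSaux.hasDeriv_right_integral (hc y) 0 t
  have h2 := DSaux.hasDeriv_right_integral (hc y) 0 0
  have h3 := h1.sub h2
  rw [hP0] at h3
  refine h3.congr' ?_
  filter_upwards [self_mem_nhdsWithin] with h hh
  have hh : 0 < h := hh
  rw [← smul_sub]
  congr 1
  rw [← (P h).intervalIntegral_comp_comm (hi _ _)]
  have : ∫ s in (0:ℝ)..t, P h (P s y) = ∫ s in (0:ℝ)..t, P (s + h) y := by
    refine intervalIntegral.integral_congr fun s hs => ?_
    rw [uIcc_of_le ht] at hs
    rw [add_comm, hPadd h s hh.le hs.1]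
  rw [this, intervalIntegral.integral_comp_add_right (fun s => P s y) h, zero_add]
  have e1 := intervalIntegral.integral_add_adjacent_intervals (hi 0 h) (hi h (t + h))
  have e2 := intervalIntegral.integral_add_adjacent_intervals (hi 0 t) (hi t (t + h))
  rw [← e1] at e2
  rw [sub_eq_sub_iff_add_eq_add, add_comm, e2, add_comm]

variable {X : Type*} [NormedAddCommGroup X] [NormedSpace ℝ X]

theorem DSaux.mild_of_strong (hP : Continuous (fun p : ℝ × Y => P p.1 p.2))
    (hP0 : ∀ y, P 0 y = y)
    (hPadd : ∀ t s, 0 ≤ t → 0 ≤ s → ∀ y, P (t + s) y = P t (P s y))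
    (e L B : X →L[ℝ] Y)
    (hL : ∀ x, Tendsto (fun h : ℝ => h⁻¹ • (P h (e x) - e x)) (𝓝[>] 0) (𝓝 (L x)))
    {w : ℝ → X} (hw : Continuous w) (hw0 : w 0 = 0) {τ : ℝ}
    (hsol : ∀ t ∈ Icc 0 τ, e (w t) = ∫ s in (0:ℝ)..t, (L + B) (w s)) :
    ∀ t ∈ Icc 0 τ, e (w t) = ∫ s in (0:ℝ)..t, P (t - s) (B (w s)) := by
  intro t ht
  have hc : ∀ y, Continuous (fun t => P t y) := fun y => hP.comp (f := fun t => (t, y)) (by fun_prop)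
  have hc1 : Continuous (fun s => P (t - s) (e (w s))) :=
    hP.comp (f := fun s => (t - s, e (w s))) (by fun_prop)
  have hc2 : Continuous (fun s => P (t - s) (B (w s))) :=
    hP.comp (f := fun s => (t - s, B (w s))) (by fun_prop)
  have hDc : Continuous (fun s => (L + B) (w s)) := by fun_prop
  have := intervalIntegral.integral_eq_sub_of_hasDeriv_right_of_le
    (f := fun s => P (t - s) (e (w s)))
    (f' := fun s => P (t - s) (B (w s))) ht.1 hc1.continuousOn ?_ (hc2.intervalIntegrable _ _)
  · rw [this]; simp [hP0, hw0]
  intro s hs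
  rw [DSaux.hasDeriv_right]
  have hA : Tendsto (fun h : ℝ => h⁻¹ • (e (w (s + h)) - e (w s))) (𝓝[>] 0)
      (𝓝 ((L + B) (w s))) := by
    refine (DSaux.hasDeriv_right_integral hDc 0 s).congr' ?_
    filter_upwards [Ioo_mem_nhdsGT (sub_pos.2 hs.2)] with h hh
    rw [hsol (s + h) ⟨by linarith [hs.1, hh.1], by linarith [hh.2, ht.2]⟩,
      hsol s ⟨hs.1.le, hs.2.le.trans ht.2⟩, intervalIntegral.integral_interval_sub_left] <;>
    exact hDc.intervalIntegrable _ _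
  have hA' : Tendsto (fun h : ℝ => P (t - s - h) (h⁻¹ • (e (w (s + h)) - e (w s)))) (𝓝[>] 0)
      (𝓝 (P (t - s) ((L + B) (w s)))) := by
    have h1 : Tendsto (fun h : ℝ => t - s - h) (𝓝[>] 0) (𝓝 (t - s)) := by
      have : Tendsto (fun h : ℝ => t - s - h) (𝓝 0) (𝓝 (t - s - 0)) :=
        Continuous.tendsto (by fun_prop) 0
      rw [sub_zero] at this
      exact this.mono_left nhdsWithin_le_nhds
    exact (hP.tendsto (t - s, (L + B) (w s))).comp (h1.prodMk_nhds hA)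
  have hB : HasDerivAt (fun r => P r (e (w s))) (P (t - s) (L (w s))) (t - s) := by
    have h1 := ((hc (L (w s))).integral_hasStrictDerivAt 0 (t - s)).hasDerivAt.const_add (e (w s))
    refine h1.congr_of_eventuallyEq ?_
    filter_upwards [Ioi_mem_nhds (sub_pos.2 hs.2)] with r hr
    exact DSaux.orbit hP hP0 hPadd (hL (w s)) (le_of_lt hr)
  have hB2 : HasDerivAt (fun r => P (t - r) (e (w s))) (-(P (t - s) (L (w s)))) s := by
    have := HasDerivAt.scomp s hB ((hasDerivAt_id s).const_sub t)
    simpa [Function.comp_def] using this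
  have hB3 := DSaux.hasDeriv_right.1 (hB2.hasDerivWithinAt (s := Ioi s))
  have := hA'.add hB3
  have e1 : P (t - s) ((L + B) (w s)) + -(P (t - s) (L (w s))) = P (t - s) (B (w s)) := by
    simp
  rw [e1] at this
  refine this.congr fun h => ?_
  rw [map_smul, ← smul_add, map_sub, sub_sub]
  congr 1
  abel

theorem DSaux.strong_of_mild (hP : Continuous (fun p : ℝ × Y => P p.1 p.2))
    (hP0 : ∀ y, P 0 y = y)
    (hPadd : ∀ t s, 0 ≤ t → 0 ≤ s → ∀ y, P (t + s) y = P t (P s y))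
    (e L B : X →L[ℝ] Y)
    (hL : ∀ x, Tendsto (fun h : ℝ => h⁻¹ • (P h (e x) - e x)) (𝓝[>] 0) (𝓝 (L x)))
    {u : ℝ → X} (hu : Continuous u) {τ : ℝ} {y : Y}
    (hsol : ∀ t ∈ Icc 0 τ, e (u t) = P t y + ∫ s in (0:ℝ)..t, P (t - s) (B (u s))) :
    ∀ t ∈ Icc 0 τ, e (u t) = y + ∫ s in (0:ℝ)..t, (L + B) (u s) := by
  intro t ht
  have hgc : ∀ r, Continuous (fun s => P (r - s) (B (u s))) := fun r =>
    hP.comp (f := fun s => (r - s, B (u s))) (by fun_prop)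
  have hDc : Continuous (fun s => (L + B) (u s)) := by fun_prop
  have hu0 : e (u 0) = y := by
    rw [hsol 0 ⟨le_rfl, ht.1.trans ht.2⟩]; simp [hP0]
  have := intervalIntegral.integral_eq_sub_of_hasDeriv_right_of_le
    (f := fun s => e (u s))
    (f' := fun s => (L + B) (u s)) ht.1 (by fun_prop) ?_ (hDc.intervalIntegrable _ _)
  · rw [this, hu0]; abel
  intro s hs
  rw [DSaux.hasDeriv_right]
  have h1 := DSaux.avg (fun h r => P (s + h - r) (B (u r)))
    (hP.comp (f := fun p : ℝ × ℝ => (s + p.1 - p.2, B (u p.2))) (by fun_prop)) s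
  simp only [add_zero, sub_self, hP0] at h1
  refine ((hL (u s)).add h1).congr' ?_
  filter_upwards [Ioo_mem_nhdsGT (sub_pos.2 hs.2)] with h hh
  rw [← smul_add]
  congr 1
  rw [hsol (s + h) ⟨by linarith [hs.1, hh.1], by linarith [hh.2, ht.2]⟩]
  have e1 : P h (e (u s)) = P (s + h) y + ∫ r in (0:ℝ)..s, P (s + h - r) (B (u r)) := by
    rw [hsol s ⟨hs.1.le, hs.2.le.trans ht.2⟩, map_add, ← hPadd h s hh.1.le hs.1.le,
      ← (P h).intervalIntegral_comp_comm ((hgc s).intervalIntegrable _ _), add_comm h s]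
    congr 1
    refine intervalIntegral.integral_congr fun r hr => ?_
    rw [uIcc_of_le hs.1.le] at hr
    rw [← hPadd h (s - r) hh.1.le (by linarith [hr.2])]
    congr 2
    ring
  rw [e1, ← intervalIntegral.integral_add_adjacent_intervals
    ((hgc (s + h)).intervalIntegrable 0 s) ((hgc (s + h)).intervalIntegrable s (s + h))]
  abel

end

/-- The translate `s ↦ f (s + t - t₀)` of (the constant extension of) `f`. -/
noncomputable def DSaux.shift {X : Type*} [NormedAddCommGroup X] (t₀ : ℝ) (ht₀ : 0 ≤ t₀)
    (f : C(Icc (0:ℝ) t₀, X)) (t : ℝ) : C(Icc (0:ℝ) t₀, X) where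
  toFun s := IccExtend ht₀ f (s + t - t₀)
  continuous_toFun := by
    have : Continuous (IccExtend ht₀ f) := f.continuous.Icc_extend'
    fun_prop

theorem DSaux.shift_norm {X : Type*} [NormedAddCommGroup X] (t₀ : ℝ) (ht₀ : 0 ≤ t₀)
    (f : C(Icc (0:ℝ) t₀, X)) (t : ℝ) : ‖DSaux.shift t₀ ht₀ f t‖ ≤ ‖f‖ := by
  rw [ContinuousMap.norm_le _ (norm_nonneg _)]
  intro s
  exact f.norm_coe_le_norm _

theorem DSaux.shift_cont {X : Type*} [NormedAddCommGroup X] (t₀ : ℝ) (ht₀ : 0 ≤ t₀)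
    (f : C(Icc (0:ℝ) t₀, X)) : Continuous (fun t => DSaux.shift t₀ ht₀ f t) := by
  refine ContinuousMap.continuous_of_continuous_uncurry _ ?_
  have : Continuous (IccExtend ht₀ f) := f.continuous.Icc_extend'
  exact this.comp (f := fun p : ℝ × Icc (0:ℝ) t₀ => (p.2 : ℝ) + p.1 - t₀) (by fun_prop)

theorem DSaux.neumann {E : Type*} [NormedAddCommGroup E] [NormedSpace ℝ E] [CompleteSpace E]
    (V₁ : E →ₗ[ℝ] E) (K : ℝ) (hK0 : 0 ≤ K) (hK1 : K < 1) (hV₁ : ∀ f, ‖V₁ f‖ ≤ K * ‖f‖) :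
    ∃ N : E →L[ℝ] E, ∀ f, N f = f + V₁ (N f) := by
  let V : E →L[ℝ] E := V₁.mkContinuous K hV₁
  have hV : ‖V‖ < 1 := (LinearMap.mkContinuous_norm_le _ hK0 _).trans_lt hK1
  let U := Units.oneSub V hV
  let N : E →L[ℝ] E := (U⁻¹ : (E →L[ℝ] E)ˣ)
  refine ⟨N, fun f => ?_⟩
  have h1 : (U : E →L[ℝ] E) * N = 1 := U.mul_inv
  have h2 : (1 - V) (N f) = f := by
    have := congrArg (fun Q : E →L[ℝ] E => Q f) h1
    exact this
  have h3 : N f - V₁ (N f) = f := h2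
  exact sub_eq_iff_eq_add.1 h3

theorem DSaux.volterra {X Y : Type*} [NormedAddCommGroup X] [NormedSpace ℝ X] [CompleteSpace X]
    [NormedAddCommGroup Y] [NormedSpace ℝ Y]
    (t₀ : ℝ) (ht₀ : 0 ≤ t₀) (K : ℝ) (hK0 : 0 ≤ K) (hK1 : K < 1)
    (J : C(Icc (0:ℝ) t₀, X) →L[ℝ] X) (hJ : ∀ f, ‖J f‖ ≤ K * ‖f‖)
    (R : Y →L[ℝ] C(Icc (0:ℝ) t₀, X)) (hR : ∀ y, R y ⟨0, le_rfl, ht₀⟩ = 0) :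
    ∃ W : Y →L[ℝ] C(Icc (0:ℝ) t₀, X), ∀ y, W y ⟨0, le_rfl, ht₀⟩ = 0 ∧
      ∀ t, W y t = R y t + J (DSaux.shift t₀ ht₀ (W y) t) := by
  let z : Icc (0:ℝ) t₀ := ⟨0, le_rfl, ht₀⟩
  let V₁ : C(Icc (0:ℝ) t₀, X) →ₗ[ℝ] C(Icc (0:ℝ) t₀, X) :=
    { toFun := fun f => ⟨fun t => J (DSaux.shift t₀ ht₀ f t),
        J.continuous.comp ((DSaux.shift_cont t₀ ht₀ f).comp continuous_subtype_val)⟩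
      map_add' := by
        intro f g
        ext t
        show J (DSaux.shift t₀ ht₀ (f + g) t) = J (DSaux.shift t₀ ht₀ f t) +
          J (DSaux.shift t₀ ht₀ g t)
        rw [← map_add]; rfl
      map_smul' := by
        intro c f
        ext t
        show J (DSaux.shift t₀ ht₀ (c • f) t) = c • J (DSaux.shift t₀ ht₀ f t)
        rw [← map_smul]; rfl }
  obtain ⟨N, hN⟩ := DSaux.neumann V₁ K hK0 hK1 (by
    intro f
    rw [ContinuousMap.norm_le _ (by positivity)]
    intro t
    refine (hJ _).trans ?_
    gcongr
    exact DSaux.shift_norm _ _ _ _)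
  have key : ∀ y t, N (R y) t = R y t + J (DSaux.shift t₀ ht₀ (N (R y)) t) := by
    intro y t
    have := congrArg (fun f : C(Icc (0:ℝ) t₀, X) => f t) (hN (R y))
    exact this
  refine ⟨N.comp R, fun y => ⟨?_, key y⟩⟩
  have h1 := key y z
  rw [hR y, zero_add] at h1
  have h2 := hJ (DSaux.shift t₀ ht₀ (N (R y)) z)
  rw [← h1] at h2
  have h3 : ‖DSaux.shift t₀ ht₀ (N (R y)) z‖ ≤ ‖N (R y) z‖ := by
    rw [ContinuousMap.norm_le _ (norm_nonneg _)]
    intro s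
    show ‖IccExtend ht₀ (N (R y)) (s + 0 - t₀)‖ ≤ _
    rw [IccExtend_of_le_left _ _ (by linarith [s.2.2])]
  have h4 : ‖N (R y) z‖ ≤ K * ‖N (R y) z‖ := h2.trans (by gcongr)
  have h5 : ‖N (R y) z‖ = 0 := by nlinarith [norm_nonneg (N (R y) z)]
  exact norm_eq_zero.1 h5

theorem DSaux.shift_integral {X Y : Type*} [NormedAddCommGroup X] [NormedSpace ℝ X]
    [NormedAddCommGroup Y] [NormedSpace ℝ Y] {P : ℝ → Y →L[ℝ] Y}
    (hP : Continuous (fun p : ℝ × Y => P p.1 p.2)) (B : X →L[ℝ] Y) (t₀ : ℝ)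
    (w : ℝ → X) (hw : Continuous w) (hw0 : ∀ s ≤ 0, w s = 0) (t : ℝ) (ht : t ≤ t₀) :
    ∫ s in (0:ℝ)..t₀, P (t₀ - s) (B (w (s + t - t₀))) = ∫ s in (0:ℝ)..t, P (t - s) (B (w s)) := by
  have hc : Continuous (fun s => P (t - s) (B (w s))) :=
    hP.comp (f := fun s => (t - s, B (w s))) (by fun_prop)
  have h1 := intervalIntegral.integral_comp_add_right (a := 0) (b := t₀)
    (fun s => P (t - s) (B (w s))) (t - t₀)
  have h2 : ∀ s, P (t₀ - s) (B (w (s + t - t₀))) =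
      P (t - (s + (t - t₀))) (B (w (s + (t - t₀)))) := by
    intro s
    congr 2
    · ring
    · congr 2; ring
  simp only [h2]
  rw [h1, ← intervalIntegral.integral_add_adjacent_intervals (hc.intervalIntegrable _ 0)
    (hc.intervalIntegrable 0 _)]
  have h3 : ∫ s in (0 + (t - t₀))..0, P (t - s) (B (w s)) = 0 := by
    rw [intervalIntegral.integral_congr (g := fun _ => (0:Y)), intervalIntegral.integral_zero]
    intro s hs
    rw [uIcc_of_le (by linarith)] at hs
    simp [hw0 s hs.2]
  rw [h3, zero_add]
  congr 1
  ring

theorem DSaux.graph {X Y : Type*} [NormedAddCommGroup X] [NormedSpace ℝ X] [CompleteSpace X]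
    [NormedAddCommGroup Y] [NormedSpace ℝ Y] [CompleteSpace Y] {P : ℝ → Y →L[ℝ] Y}
    (hP : Continuous (fun p : ℝ × Y => P p.1 p.2))
    (hP0 : ∀ y, P 0 y = y)
    (hPadd : ∀ t s, 0 ≤ t → 0 ≤ s → ∀ y, P (t + s) y = P t (P s y))
    (e : X →L[ℝ] Y) (he : Function.Injective e) (l : X → Y)
    (hl : ∀ x, Tendsto (fun h : ℝ => h⁻¹ • (P h (e x) - e x)) (𝓝[>] 0) (𝓝 (l x)))
    (hdom : ∀ v z, Tendsto (fun h : ℝ => h⁻¹ • (P h v - v)) (𝓝[>] 0) (𝓝 z) → ∃ x, e x = v)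
    (t₀ : ℝ) (ht₀ : 0 ≤ t₀) :
    ∃ L : X →L[ℝ] Y, (∀ x, L x = l x) ∧
      ∃ R : Y →L[ℝ] C(Icc (0:ℝ) t₀, X), ∀ y t, e (R y t) = ∫ s in (0:ℝ)..t, P s y := by
  have hc : ∀ y, Continuous (fun t => P t y) := fun y => hP.comp (f := fun t => (t, y)) (by fun_prop)
  have hIc : Continuous (fun p : Y × ℝ => ∫ s in (0:ℝ)..p.2, P s p.1) := by
    refine intervalIntegral.continuous_parametric_intervalIntegral_of_continuous
      (f := fun (p : Y × ℝ) s => P s p.1) ?_ continuous_snd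
    exact hP.comp (f := fun q : (Y × ℝ) × ℝ => (q.2, q.1.1)) (by fun_prop)
  -- closedness of the generator
  have hclosed : ∀ (u : ℕ → X) (v z : Y), Tendsto (fun n => e (u n)) atTop (𝓝 v) →
      Tendsto (fun n => l (u n)) atTop (𝓝 z) → ∃ x, e x = v ∧ l x = z := by
    intro u v z hv hz
    have horb : ∀ t, 0 ≤ t → P t v = v + ∫ s in (0:ℝ)..t, P s z := by
      intro t ht
      have h1 : Tendsto (fun n => P t (e (u n))) atTop (𝓝 (P t v)) :=
        ((P t).continuous.tendsto v).comp hv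
      have h2 : Tendsto (fun n => ∫ s in (0:ℝ)..t, P s (l (u n))) atTop
          (𝓝 (∫ s in (0:ℝ)..t, P s z)) :=
        (hIc.tendsto (z, t)).comp (hz.prodMk_nhds tendsto_const_nhds)
      refine tendsto_nhds_unique h1 ((hv.add h2).congr fun n => ?_)
      exact (DSaux.orbit hP hP0 hPadd (hl (u n)) ht).symm
    have hlim : Tendsto (fun h : ℝ => h⁻¹ • (P h v - v)) (𝓝[>] 0) (𝓝 z) := by
      have h1 := DSaux.hasDeriv_right_integral (hc z) 0 0
      rw [hP0] at h1
      refine h1.congr' ?_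
      filter_upwards [self_mem_nhdsWithin] with h hh
      rw [horb h (le_of_lt hh)]
      simp
    obtain ⟨x, rfl⟩ := hdom v z hlim
    exact ⟨x, rfl, tendsto_nhds_unique (hl x) hlim⟩
  let L₀ : X →ₗ[ℝ] Y :=
    { toFun := l
      map_add' := by
        intro x y
        refine tendsto_nhds_unique (hl (x + y)) (((hl x).add (hl y)).congr fun h => ?_)
        simp only [map_add]
        rw [← smul_add]; congr 1; abel
      map_smul' := by
        intro c x
        refine tendsto_nhds_unique (hl (c • x)) (((hl x).const_smul c).congr fun h => ?_)
        simp only [map_smul]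
        rw [smul_comm, smul_sub] }
  have hL₀ : Continuous L₀ := by
    refine L₀.continuous_of_seq_closed_graph fun u x y hu hy => ?_
    obtain ⟨x', h1, h2⟩ := hclosed u (e x) y ((e.continuous.tendsto x).comp hu) hy
    rw [← h2, he h1]
    rfl
  let L : X →L[ℝ] Y := ⟨L₀, hL₀⟩
  refine ⟨L, fun x => rfl, ?_⟩
  let G : X →L[ℝ] Y × Y := e.prod L
  have hGinj : Function.Injective G := fun x y h => he (congrArg Prod.fst h)
  have hGcl : IsClosed (range G) := by
    refine IsSeqClosed.isClosed ?_
    rintro u ⟨v, z⟩ hu hlim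
    choose x hx using hu
    have hlim' : Tendsto (fun n => G (x n)) atTop (𝓝 (v, z)) := by simpa only [hx] using hlim
    obtain ⟨x', h1, h2⟩ := hclosed x v z ((continuous_fst.tendsto (v, z)).comp hlim')
      ((continuous_snd.tendsto (v, z)).comp hlim')
    exact ⟨x', Prod.ext h1 h2⟩
  obtain ⟨c, hcG⟩ := G.antilipschitz_of_injective_of_isClosed_range hGinj hGcl
  have hemb : IsEmbedding G := (hcG.isUniformEmbedding G.uniformContinuous).isEmbedding
  have hex : ∀ (y : Y) (t : Icc (0:ℝ) t₀), ∃ x, e x = ∫ s in (0:ℝ)..t, P s y ∧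
      l x = P t y - y := by
    intro y t
    have h1 := DSaux.integral_mem hP hP0 hPadd y t.2.1
    obtain ⟨x, hx⟩ := hdom _ _ h1
    refine ⟨x, hx, ?_⟩
    rw [← hx] at h1
    exact tendsto_nhds_unique (hl x) h1
  choose r hr1 hr2 using hex
  have hrc : Continuous (fun p : Y × Icc (0:ℝ) t₀ => r p.1 p.2) := by
    rw [hemb.continuous_iff]
    have : G ∘ (fun p : Y × Icc (0:ℝ) t₀ => r p.1 p.2) =
        fun p => (∫ s in (0:ℝ)..p.2, P s p.1, P p.2 p.1 - p.1) := by
      funext p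
      exact Prod.ext (hr1 _ _) (hr2 _ _)
    rw [this]
    refine Continuous.prodMk ?_ (Continuous.sub ?_ continuous_fst)
    · exact hIc.comp (f := fun p : Y × Icc (0:ℝ) t₀ => (p.1, (p.2 : ℝ))) (by fun_prop)
    · exact hP.comp (f := fun p : Y × Icc (0:ℝ) t₀ => ((p.2 : ℝ), p.1)) (by fun_prop)
  let R₀ : Y →ₗ[ℝ] C(Icc (0:ℝ) t₀, X) :=
    { toFun := fun y => ⟨fun t => r y t, hrc.comp (f := fun t => (y, t)) (by fun_prop)⟩
      map_add' := by
        intro y z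
        ext t
        show r (y + z) t = r y t + r z t
        apply he
        rw [map_add, hr1, hr1, hr1, ← intervalIntegral.integral_add
          ((hc y).intervalIntegrable _ _) ((hc z).intervalIntegrable _ _)]
        simp only [map_add]
      map_smul' := by
        intro a y
        ext t
        show r (a • y) t = a • r y t
        apply he
        rw [map_smul, hr1, hr1, ← intervalIntegral.integral_smul]
        simp only [map_smul] }
  have hR₀ : Continuous R₀ := ContinuousMap.continuous_of_continuous_uncurry _ hrc
  exact ⟨⟨R₀, hR₀⟩, fun y t => hr1 y t⟩


/-- **Desch–Schappacher perturbation theorem on Banach spaces**, with a general Banach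
superspace `Xb` (playing the role of `X̄ ⊇ X`) in place of the extrapolation space `X₋₁`.

`A` (with domain `domA`) generates the `C₀`-semigroup `T` on the Banach space `X`;
`e : X → Xb` is the injective continuous inclusion with dense range; `Ab` generates the
`C₀`-semigroup `Tb` on `Xb` with domain `D(Ab) = X` (the range of `e`) and
`Tb t ∘ e = e ∘ T t`; `B : X → Xb` is bounded linear; `t₀ > 0` and `K ∈ (0,1)` are such
that conditions (i) and (ii) hold.  Then `C x = Ab x + B x`, with domain
`domC = {x ∈ X : Ab x + B x ∈ X}`, generates a `C₀`-semigroup on `X`. -/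
theorem desch_schappacher_banach
    {X Xb : Type*}
    [NormedAddCommGroup X] [NormedSpace ℝ X] [CompleteSpace X]
    [NormedAddCommGroup Xb] [NormedSpace ℝ Xb] [CompleteSpace Xb]
    (T : ℝ → X →L[ℝ] X) (hT : IsC0Semigroup T)
    (domA : Set X) (A : X → X) (hA : IsGenerator T domA A)
    (e : X →L[ℝ] Xb) (he : Function.Injective e) (hedense : DenseRange e)
    (Tb : ℝ → Xb →L[ℝ] Xb) (hTb : IsC0Semigroup Tb)
    (Ab : Xb → Xb) (hAb : IsGenerator Tb (Set.range e) Ab)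
    (hTbe : ∀ t : ℝ, 0 ≤ t → ∀ x : X, Tb t (e x) = e (T t x))
    (B : X →L[ℝ] Xb)
    (t₀ : ℝ) (ht₀ : 0 < t₀)
    -- condition (i): the integral `∫₀^{t₀} T̄(t₀ - t) B f(t) dt` belongs to `X`
    (hi : ∀ f : ℝ → X, ContinuousOn f (Icc (0 : ℝ) t₀) →
      ∃ x : X, e x = ∫ t in (0 : ℝ)..t₀, Tb (t₀ - t) (B (f t)))
    -- condition (ii): `‖∫₀^{t₀} T̄(t₀ - t) B f(t) dt‖ ≤ K · sup_{t ∈ [0,t₀]} ‖f t‖`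
    (K : ℝ) (hK : K ∈ Ioo (0 : ℝ) 1)
    (hii : ∀ f : ℝ → X, ContinuousOn f (Icc (0 : ℝ) t₀) → ∀ x : X,
      e x = ∫ t in (0 : ℝ)..t₀, Tb (t₀ - t) (B (f t)) →
        ‖x‖ ≤ K * ⨆ t ∈ Icc (0 : ℝ) t₀, ‖f t‖)
    -- the perturbed operator `C = (Ā + B)|_X`
    (domC : Set X) (hdomC : domC = {x : X | ∃ y : X, e y = Ab (e x) + B x})
    (C : X → X) (hC : ∀ x ∈ domC, e (C x) = Ab (e x) + B x) :
    ∃ S : ℝ → X →L[ℝ] X, IsC0Semigroup S ∧ IsGenerator S domC C := by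
  have hsg := hTb
  obtain ⟨hTb0, hTbadd, hTbc⟩ := hTb
  set P : ℝ → Xb →L[ℝ] Xb := fun t => Tb (max t 0) with hPdef
  have hPT : ∀ t, 0 ≤ t → P t = Tb t := fun t ht => by simp only [hPdef]; rw [max_eq_left ht]
  have hP : Continuous (fun p : ℝ × Xb => P p.1 p.2) := DSaux.joint_cont Tb hsg
  have hP0 : ∀ y, P 0 y = y := fun y => by rw [hPT 0 le_rfl, hTb0]; rfl
  have hPadd : ∀ t s, 0 ≤ t → 0 ≤ s → ∀ y, P (t + s) y = P t (P s y) := by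
    intro t s ht hs y
    rw [hPT _ (add_nonneg ht hs), hPT _ ht, hPT _ hs, hTbadd t s ht hs]; rfl
  have hPev : ∀ v : Xb, (fun h : ℝ => h⁻¹ • (P h v - v)) =ᶠ[𝓝[>] 0]
      fun h : ℝ => h⁻¹ • (Tb h v - v) := by
    intro v
    filter_upwards [self_mem_nhdsWithin] with h hh
    rw [hPT h (le_of_lt hh)]
  have hl : ∀ x, Tendsto (fun h : ℝ => h⁻¹ • (P h (e x) - e x)) (𝓝[>] 0) (𝓝 (Ab (e x))) :=
    fun x => (hAb.2 (e x) ⟨x, rfl⟩).congr' (hPev _).symm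
  have hdom : ∀ v z, Tendsto (fun h : ℝ => h⁻¹ • (P h v - v)) (𝓝[>] 0) (𝓝 z) →
      ∃ x, e x = v := fun v z h => (hAb.1 v).2 ⟨z, h.congr' (hPev v)⟩
  obtain ⟨L, hL, R, hR⟩ := DSaux.graph hP hP0 hPadd e he (fun x => Ab (e x)) hl hdom t₀ ht₀.le
  have hl' : ∀ x, Tendsto (fun h : ℝ => h⁻¹ • (P h (e x) - e x)) (𝓝[>] 0) (𝓝 (L x)) := by
    intro x; rw [hL]; exact hl x
  -- the conditions in terms of `P`
  have hint : ∀ f : ℝ → X, ∫ t in (0 : ℝ)..t₀, Tb (t₀ - t) (B (f t)) =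
      ∫ t in (0 : ℝ)..t₀, P (t₀ - t) (B (f t)) := by
    intro f
    refine intervalIntegral.integral_congr fun s hs => ?_
    rw [uIcc_of_le ht₀.le] at hs
    rw [hPT _ (by linarith [hs.2])]
  have hbound : ∀ f : ℝ → X, Continuous f → ∀ M, 0 ≤ M → (∀ s ∈ Icc 0 t₀, ‖f s‖ ≤ M) → ∀ x,
      e x = ∫ t in (0 : ℝ)..t₀, P (t₀ - t) (B (f t)) → ‖x‖ ≤ K * M := by
    intro f hf M hM hfM x hx
    refine (hii f hf.continuousOn x (by rw [hint]; exact hx)).trans ?_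
    refine mul_le_mul_of_nonneg_left ?_ hK.1.le
    exact Real.iSup_le (fun t => Real.iSup_le (fun ht => hfM t ht) hM) hM
  have hJex : ∀ f : C(Icc (0:ℝ) t₀, X), ∃ x : X, e x =
      ∫ t in (0 : ℝ)..t₀, P (t₀ - t) (B (IccExtend ht₀.le f t)) := by
    intro f
    obtain ⟨x, hx⟩ := hi (IccExtend ht₀.le f) f.continuous.Icc_extend'.continuousOn
    exact ⟨x, by rw [hx, hint]⟩
  choose j hj using hJex
  have hjc : ∀ f : C(Icc (0:ℝ) t₀, X),
      Continuous (fun t => P (t₀ - t) (B (IccExtend ht₀.le f t))) := by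
    intro f
    have : Continuous (IccExtend ht₀.le f) := f.continuous.Icc_extend'
    exact hP.comp (f := fun t => (t₀ - t, B (IccExtend ht₀.le f t))) (by fun_prop)
  let J₀ : C(Icc (0:ℝ) t₀, X) →ₗ[ℝ] X :=
    { toFun := j
      map_add' := by
        intro f g
        apply he
        rw [map_add, hj, hj, hj, ← intervalIntegral.integral_add
          ((hjc f).intervalIntegrable _ _) ((hjc g).intervalIntegrable _ _)]
        refine intervalIntegral.integral_congr fun s hs => ?_
        simp [IccExtend]
      map_smul' := by
        intro a f
        apply he
        rw [map_smul, hj, hj, ← intervalIntegral.integral_smul]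
        refine intervalIntegral.integral_congr fun s hs => ?_
        simp [IccExtend] }
  have hJ₀ : ∀ f, ‖J₀ f‖ ≤ K * ‖f‖ := fun f =>
    hbound (IccExtend ht₀.le f) f.continuous.Icc_extend' ‖f‖ (norm_nonneg _)
      (fun s _ => f.norm_coe_le_norm _) _ (hj f)
  let J : C(Icc (0:ℝ) t₀, X) →L[ℝ] X := J₀.mkContinuous K hJ₀
  obtain ⟨W, hW⟩ := DSaux.volterra t₀ ht₀.le K hK.1.le hK.2 J hJ₀ R (by
    intro y
    apply he
    rw [hR, map_zero]
    simp)
  -- mild equation for `W`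
  have hWext : ∀ y, Continuous (IccExtend ht₀.le (W y)) := fun y => (W y).continuous.Icc_extend'
  have hWmild : ∀ y, ∀ t ∈ Icc 0 t₀, e (IccExtend ht₀.le (W y) t) =
      (∫ s in (0:ℝ)..t, P s y) + ∫ s in (0:ℝ)..t, P (t - s) (B (IccExtend ht₀.le (W y) s)) := by
    intro y t ht
    rw [IccExtend_of_mem _ _ ht, (hW y).2 ⟨t, ht⟩, map_add, hR]
    congr 1
    refine (hj _).trans ?_
    rw [← DSaux.shift_integral hP B t₀ _ (hWext y) ?_ t ht.2]
    · refine intervalIntegral.integral_congr fun s hs => ?_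
      rw [uIcc_of_le ht₀.le] at hs
      simp only
      rw [IccExtend_of_mem _ _ hs]
      rfl
    · intro s hs
      rw [IccExtend_of_le_left _ _ hs]
      exact (hW y).1
  set D : X →L[ℝ] Xb := L + B with hD
  let S₀ : ℝ → X →L[ℝ] X := fun t => ContinuousLinearMap.id ℝ X +
    (ContinuousMap.evalCLM ℝ (projIcc 0 t₀ ht₀.le t)).comp (W.comp D)
  have hS₀ : ∀ t x, S₀ t x = x + IccExtend ht₀.le (W (D x)) t := fun t x => rfl
  have hcont : ∀ x, Continuous (fun t => S₀ t x) := fun x => by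
    simp only [hS₀]
    exact continuous_const.add (hWext _)
  have hfin := DSaux.stage3 e D t₀ ht₀ S₀ hcont ?_ ?_ ?_ ?_
  · obtain ⟨S, hS, hgen⟩ := hfin
    have hDA : ∀ x, D x = Ab (e x) + B x := fun x => by
      rw [hD, ContinuousLinearMap.add_apply, hL]
    refine ⟨S, hS, fun x => ?_, fun x hx => ?_⟩
    · rw [hdomC]
      simp only [mem_setOf_eq, ← hDA, hgen]
    · rw [← hgen, hDA]
      exact hC x hx
  · refine ⟨1 + ‖W.comp D‖, fun t _ => ContinuousLinearMap.opNorm_le_bound _ (by positivity)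
      fun x => ?_⟩
    rw [hS₀, add_mul, one_mul]
    refine (norm_add_le _ _).trans ?_
    gcongr
    exact ((W (D x)).norm_coe_le_norm _).trans ((W.comp D).le_opNorm x)
  · ext x
    rw [hS₀, IccExtend_of_le_left _ _ le_rfl, (hW (D x)).1]
    simp
  · intro x
    refine DSaux.strong_of_mild hP hP0 hPadd e L B hl' (hcont x) (fun t ht => ?_)
    have hPc : ∀ y, Continuous (fun t => P t y) :=
      fun y => hP.comp (f := fun t => (t, y)) (by fun_prop)
    have hc1 : Continuous (fun s => P (t - s) (B x)) := (hPc (B x)).comp (by fun_prop)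
    have hc2 : Continuous (fun s => P (t - s) (B (IccExtend ht₀.le (W (D x)) s))) := by
      have := hWext (D x)
      exact hP.comp (f := fun s => (t - s, B (IccExtend ht₀.le (W (D x)) s))) (by fun_prop)
    simp only [hS₀, map_add]
    rw [hWmild _ t ht, DSaux.orbit hP hP0 hPadd (hl' x) ht.1,
      intervalIntegral.integral_add (hc1.intervalIntegrable _ _) (hc2.intervalIntegrable _ _),
      intervalIntegral.integral_comp_sub_left (fun s => P s (B x)) t]
    have : ∫ s in (0:ℝ)..t, P s (D x) = (∫ s in (0:ℝ)..t, P s (L x)) +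
        ∫ s in (0:ℝ)..t, P s (B x) := by
      rw [← intervalIntegral.integral_add ((hPc _).intervalIntegrable _ _)
        ((hPc _).intervalIntegrable _ _)]
      simp [hD]
    rw [this]
    simp only [sub_self, sub_zero]
    abel
  · intro τ hτ hτ' w hw hw0 hsol
    have hmild := DSaux.mild_of_strong hP hP0 hPadd e L B hl' hw hw0 hsol
    obtain ⟨m, hm, hmax⟩ := (isCompact_Icc (a := 0) (b := τ)).exists_isMaxOn
      ⟨0, le_rfl, hτ⟩ hw.norm.continuousOn
    let v : ℝ → X := fun s => w (max 0 (min s τ))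
    have hv : Continuous v := hw.comp (by fun_prop)
    have hvM : ∀ s, ‖v s‖ ≤ ‖w m‖ := fun s =>
      hmax (show max 0 (min s τ) ∈ Icc 0 τ from
        ⟨le_max_left _ _, max_le hτ (min_le_right _ _)⟩)
    have hv0 : ∀ s ≤ 0, v s = 0 := by
      intro s hs
      simp only [v]
      rw [max_eq_left ((min_le_left _ _).trans hs), hw0]
    have hle := hbound (fun s => v (s + m - t₀)) (hv.comp (by fun_prop)) ‖w m‖ (norm_nonneg _)
      (fun s _ => hvM _) (w m) ?_
    · have h5 : ‖w m‖ = 0 := by nlinarith [norm_nonneg (w m), hK.2]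
      intro t ht
      have : ‖w t‖ ≤ ‖w m‖ := hmax ht
      rw [h5] at this
      exact norm_le_zero_iff.1 this
    · rw [DSaux.shift_integral hP B t₀ v hv hv0 m (hm.2.trans hτ'), hmild m hm]
      refine intervalIntegral.integral_congr fun s hs => ?_
      rw [uIcc_of_le hm.1] at hs
      simp only [v]
      rw [min_eq_left (hs.2.trans hm.2), max_eq_right hs.1]
end

section
/- Let b > 0 and 1 < p < ∞, and let X = L^p_loc((−∞,b]) be the Fréchet space of (equivalence classes of) locally p-integrable functions on (−∞,b] with the fundamental system of seminorms p_n(x) = (∫_{−n}^{b} |x(t)|^p dt)^{1/p}, n ∈ ℕ. For t ≥ 0 define T(t) : X → X by (T(t)x)(s) = x(s+t) if s + t ≤ b and (T(t)x)(s) = 0 if s + t > b. Then (T(t))_{t≥0} is an equicontinuous C₀-semigroup on X satisfying p_n(T(t)x) ≤ p_n(x) for all n ∈ ℕ, t ≥ 0 and x ∈ X, and its generator is the operator A x = x′ with domain D(A) = {x ∈ W^{1,p}_loc((−∞,b]) : x(b) = 0}. -/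
open MeasureTheory Set Filter Topology

namespace DS

/-- The seminorm `p_n(f) = (∫_{-n}^b |f t|^p dt)^{1/p}` on `L^p_loc((-∞,b])`, at the level
of representative functions. -/
noncomputable def locLpSeminorm (b q : ℝ) (n : ℕ) (f : ℝ → ℝ) : ℝ :=
  (∫ t in Icc (-(n : ℝ)) b, |f t| ^ q) ^ (1 / q)

/-- Membership in `L^p_loc((-∞,b])`, at the level of representative functions: `f` is
measurable on `(-∞,b]` and `|f|^p` is integrable on every `[-n,b]`. -/
def MemLpLoc (b q : ℝ) (f : ℝ → ℝ) : Prop :=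
  AEStronglyMeasurable f (volume.restrict (Iic b)) ∧
    ∀ n : ℕ, IntegrableOn (fun t : ℝ => |f t| ^ q) (Icc (-(n : ℝ)) b) volume

end DS

open DS

namespace DS

lemma mp_add (t : ℝ) : MeasurePreserving (fun s : ℝ => s + t) volume volume :=
  measurePreserving_add_right volume t

lemma memLp_of_loc {b q : ℝ} (hq : 1 < q) {f : ℝ → ℝ} (hf : MemLpLoc b q f) (n : ℕ) :
    MemLp f (ENNReal.ofReal q) (volume.restrict (Icc (-(n : ℝ)) b)) := by
  have h1 : AEStronglyMeasurable f (volume.restrict (Icc (-(n : ℝ)) b)) :=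
    hf.1.mono_measure (Measure.restrict_mono Icc_subset_Iic_self le_rfl)
  have h2 := hf.2 n
  rw [← integrable_norm_rpow_iff h1 (by simp; linarith) (by simp)]
  rw [ENNReal.toReal_ofReal (by linarith)]
  exact h2

lemma loc_of_memLp {b q : ℝ} (hq : 1 < q) {f : ℝ → ℝ}
    (hf : AEStronglyMeasurable f (volume.restrict (Iic b)))
    (h : ∀ n : ℕ, MemLp f (ENNReal.ofReal q) (volume.restrict (Icc (-(n : ℝ)) b))) :
    MemLpLoc b q f := by
  refine ⟨hf, fun n => ?_⟩
  have := (integrable_norm_rpow_iff (h n).1 (by simp; linarith) (by simp)).2 (h n)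
  rw [ENNReal.toReal_ofReal (by linarith)] at this
  exact this

lemma seminorm_eq {b q : ℝ} (hq : 1 < q) {f : ℝ → ℝ} {n : ℕ}
    (hf : MemLp f (ENNReal.ofReal q) (volume.restrict (Icc (-(n : ℝ)) b))) :
    locLpSeminorm b q n f =
      (eLpNorm f (ENNReal.ofReal q) (volume.restrict (Icc (-(n : ℝ)) b))).toReal := by
  rw [hf.eLpNorm_eq_integral_rpow_norm (by simp; linarith) (by simp),
    ENNReal.toReal_ofReal (by positivity), ENNReal.toReal_ofReal (by linarith)]
  simp [locLpSeminorm]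

lemma memLp_ind {b q : ℝ} (hq : 1 < q) {f : ℝ → ℝ} (hf : MemLpLoc b q f) (n : ℕ) :
    MemLp (indicator (Icc (-(n : ℝ)) b) f) (ENNReal.ofReal q) volume :=
  (memLp_indicator_iff_restrict measurableSet_Icc).2 (memLp_of_loc hq hf n)

lemma translation_cont {q : ℝ} (hq : 1 < q) {F : ℝ → ℝ}
    (hF : MemLp F (ENNReal.ofReal q) volume) (r : ℝ) :
    Tendsto (fun t : ℝ => eLpNorm (fun s => F (s + t) - F (s + r)) (ENNReal.ofReal q) volume)
      (𝓝 r) (𝓝 0) := by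
  have : Fact (1 ≤ ENNReal.ofReal q) := ⟨by simp; linarith⟩
  let g : ℝ → C(ℝ, ℝ) := fun t => ⟨fun s => s + t, by fun_prop⟩
  have hg : Continuous g := by
    apply ContinuousMap.continuous_of_continuous_uncurry
    simp only [g, Function.uncurry_def, ContinuousMap.coe_mk]
    fun_prop
  have hgm : ∀ t, MeasurePreserving (g t) volume volume := fun t => mp_add t
  have h := (Continuous.compMeasurePreservingLp (f := fun _ : ℝ => hF.toLp F)
    continuous_const hg hgm (by simp)).tendsto r
  rw [tendsto_iff_edist_tendsto_0] at h
  refine h.congr fun t => ?_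
  rw [Lp.toLp_compMeasurePreserving hF (hgm t), Lp.toLp_compMeasurePreserving hF (hgm r),
    Lp.edist_toLp_toLp]
  rfl

/-- Key estimate for averages. -/
lemma avg_est {q : ℝ} (hq : 1 < q) {D : ℝ → ℝ} (hD : Measurable D) {h : ℝ} (hh : 0 < h)
    (ε : ENNReal)
    (hε : ∀ r ∈ Ioc 0 h, eLpNorm (fun s => D (s + r) - D s) (ENNReal.ofReal q) volume ≤ ε) :
    eLpNorm (fun s => h⁻¹ * ∫ r in (0 : ℝ)..h, (D (s + r) - D s)) (ENNReal.ofReal q) volume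
      ≤ ε := by
  have q0 : 0 < q := by linarith
  have Q0 : ENNReal.ofReal q ≠ 0 := by simp; linarith
  have Qt : ENNReal.ofReal q ≠ ⊤ := by simp
  set ν : Measure ℝ := (ENNReal.ofReal h)⁻¹ • volume.restrict (Ioc 0 h) with hν
  have : IsProbabilityMeasure ν := ⟨by
    simp only [hν, Measure.smul_apply, Measure.restrict_apply_univ, Real.volume_Ioc, sub_zero,
      smul_eq_mul]
    exact ENNReal.inv_mul_cancel (by simpa using hh) (by simp)⟩
  have hmeas : Measurable (fun z : ℝ × ℝ => ‖D (z.1 + z.2) - D z.1‖ₑ ^ q) := by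
    have : Measurable (fun z : ℝ × ℝ => D (z.1 + z.2) - D z.1) :=
      (hD.comp (measurable_fst.add measurable_snd)).sub (hD.comp measurable_fst)
    exact this.enorm.pow_const q
  have key : ∀ r ∈ Ioc 0 h, ∫⁻ s, ‖D (s + r) - D s‖ₑ ^ q ≤ ε ^ q := by
    intro r hr
    have := hε r hr
    rw [eLpNorm_eq_lintegral_rpow_enorm_toReal Q0 Qt, ENNReal.toReal_ofReal q0.le] at this
    have h2 := ENNReal.rpow_le_rpow this q0.le
    rwa [← ENNReal.rpow_mul, one_div, inv_mul_cancel₀ q0.ne', ENNReal.rpow_one] at h2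
  have pt : ∀ s, ‖h⁻¹ * ∫ r in (0 : ℝ)..h, (D (s + r) - D s)‖ₑ ^ q
      ≤ ∫⁻ r, ‖D (s + r) - D s‖ₑ ^ q ∂ν := by
    intro s
    have e1 : h⁻¹ * ∫ r in (0 : ℝ)..h, (D (s + r) - D s) = ∫ r, (D (s + r) - D s) ∂ν := by
      rw [hν, integral_smul_measure, intervalIntegral.integral_of_le hh.le]
      simp [hh.le]
    rw [e1]
    have m1 : AEStronglyMeasurable (fun r => D (s + r) - D s) ν :=
      ((hD.comp (measurable_const.add measurable_id)).sub measurable_const).aestronglyMeasurable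
    have e2 : ‖∫ r, (D (s + r) - D s) ∂ν‖ₑ
        ≤ eLpNorm (fun r => D (s + r) - D s) (ENNReal.ofReal q) ν := by
      refine (enorm_integral_le_lintegral_enorm _).trans ?_
      rw [← eLpNorm_one_eq_lintegral_enorm]
      exact eLpNorm_le_eLpNorm_of_exponent_le (by simp; linarith) m1
    rw [eLpNorm_eq_lintegral_rpow_enorm_toReal Q0 Qt, ENNReal.toReal_ofReal q0.le] at e2
    have h2 := ENNReal.rpow_le_rpow e2 q0.le
    rwa [← ENNReal.rpow_mul, one_div, inv_mul_cancel₀ q0.ne', ENNReal.rpow_one] at h2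
  rw [eLpNorm_eq_lintegral_rpow_enorm_toReal Q0 Qt, ENNReal.toReal_ofReal q0.le]
  have tot : ∫⁻ s, ‖h⁻¹ * ∫ r in (0 : ℝ)..h, (D (s + r) - D s)‖ₑ ^ q ≤ ε ^ q := by
    calc _ ≤ ∫⁻ s, ∫⁻ r, ‖D (s + r) - D s‖ₑ ^ q ∂ν := lintegral_mono pt
      _ = ∫⁻ r, (∫⁻ s, ‖D (s + r) - D s‖ₑ ^ q) ∂ν :=
        lintegral_lintegral_swap hmeas.aemeasurable
      _ ≤ ∫⁻ r, ε ^ q ∂ν := by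
        apply lintegral_mono_ae
        have : ∀ᵐ r ∂(volume.restrict (Ioc 0 h)), r ∈ Ioc 0 h :=
          ae_restrict_mem measurableSet_Ioc
        have : ∀ᵐ r ∂ν, r ∈ Ioc 0 h := Measure.ae_smul_measure this _
        filter_upwards [this] with r hr using key r hr
      _ = ε ^ q := by simp
  have h2 := ENNReal.rpow_le_rpow tot (show 0 ≤ 1 / q by positivity)
  rwa [← ENNReal.rpow_mul, mul_one_div_cancel q0.ne', ENNReal.rpow_one] at h2

lemma avg_tendsto {q : ℝ} (hq : 1 < q) {D : ℝ → ℝ} (hD : Measurable D)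
    (hDm : MemLp D (ENNReal.ofReal q) volume) :
    Tendsto (fun h : ℝ => eLpNorm (fun s => h⁻¹ * ∫ r in (0 : ℝ)..h, (D (s + r) - D s))
      (ENNReal.ofReal q) volume) (𝓝[>] (0 : ℝ)) (𝓝 0) := by
  rw [ENNReal.tendsto_nhds_zero]
  intro ε hε
  have h1 := ENNReal.tendsto_nhds_zero.1 (translation_cont hq hDm 0) ε hε
  simp only [add_zero] at h1
  obtain ⟨δ, hδ, hball⟩ := Metric.eventually_nhds_iff.1 h1
  have : ∀ᶠ h in 𝓝[>] (0 : ℝ), h ∈ Ioo 0 δ := Ioo_mem_nhdsGT hδ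
  filter_upwards [this] with h hh
  refine avg_est hq hD hh.1 ε fun r hr => hball ?_
  rw [Real.dist_eq, sub_zero, abs_of_pos hr.1]
  exact hr.2.trans_lt hh.2

lemma intInt {b q : ℝ} (hq : 1 < q) {d : ℝ → ℝ} (hd : MemLpLoc b q d) {s t : ℝ} (hst : s ≤ t)
    (ht : t ≤ b) : IntervalIntegrable d volume s t := by
  obtain ⟨n, hn⟩ := exists_nat_ge (-s)
  have h := (memLp_of_loc hq hd n).integrable (by simp; linarith)
  rw [intervalIntegrable_iff_integrableOn_Icc_of_le hst]
  exact IntegrableOn.mono_set h (Icc_subset_Icc (by linarith) ht)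

lemma ind_loc {b q : ℝ} (hq : 1 < q) {f : ℝ → ℝ} (hf : MemLpLoc b q f) (n : ℕ) :
    LocallyIntegrable (indicator (Icc (-(n : ℝ)) b) f) volume :=
  (memLp_ind hq hf n).locallyIntegrable (by simp; linarith)

lemma ind_int {b q : ℝ} (hq : 1 < q) {f : ℝ → ℝ} (hf : MemLpLoc b q f) (n : ℕ) (s t : ℝ) :
    IntervalIntegrable (indicator (Icc (-(n : ℝ)) b) f) volume s t :=
  ((ind_loc hq hf n).integrableOn_isCompact isCompact_uIcc).intervalIntegrable

section
variable {b q : ℝ} {T : ℝ → (ℝ → ℝ) → ℝ → ℝ}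

lemma T_eq (hT : ∀ (t : ℝ) (f : ℝ → ℝ) (s : ℝ), T t f s = if s + t ≤ b then f (s + t) else 0)
    {t : ℝ} (ht : 0 ≤ t) (f : ℝ → ℝ) {n : ℕ} {s : ℝ} (hs : s ∈ Icc (-(n : ℝ)) b) :
    T t f s = indicator (Icc (-(n : ℝ)) b) f (s + t) := by
  rw [hT, indicator_apply]
  have : s + t ∈ Icc (-(n : ℝ)) b ↔ s + t ≤ b :=
    ⟨fun h => h.2, fun h => ⟨by linarith [hs.1], h⟩⟩
  simp only [this]

lemma T_ae (hT : ∀ (t : ℝ) (f : ℝ → ℝ) (s : ℝ), T t f s = if s + t ≤ b then f (s + t) else 0)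
    {t : ℝ} (ht : 0 ≤ t) (f : ℝ → ℝ) (n : ℕ) :
    T t f =ᵐ[volume.restrict (Icc (-(n : ℝ)) b)]
      (indicator (Icc (-(n : ℝ)) b) f) ∘ (fun s => s + t) := by
  filter_upwards [ae_restrict_mem measurableSet_Icc] with s hs
  exact T_eq hT ht f hs

lemma T_mem (hq : 1 < q)
    (hT : ∀ (t : ℝ) (f : ℝ → ℝ) (s : ℝ), T t f s = if s + t ≤ b then f (s + t) else 0)
    {t : ℝ} (ht : 0 ≤ t) {f : ℝ → ℝ} (hf : MemLpLoc b q f) : MemLpLoc b q (T t f) := by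
  apply loc_of_memLp hq
  · have h1 : AEStronglyMeasurable (indicator (Iic b) f) volume :=
      (aestronglyMeasurable_indicator_iff measurableSet_Iic).2 hf.1
    have h2 := h1.comp_measurePreserving (mp_add t)
    have : T t f = indicator (Iic b) f ∘ (fun s => s + t) := by
      funext s
      simp [hT, indicator_apply]
    rw [this]
    exact h2.restrict
  · intro n
    refine MemLp.ae_eq (T_ae hT ht f n).symm ?_
    exact ((memLp_ind hq hf n).comp_measurePreserving (mp_add t)).restrict _

lemma T_le (hq : 1 < q)
    (hT : ∀ (t : ℝ) (f : ℝ → ℝ) (s : ℝ), T t f s = if s + t ≤ b then f (s + t) else 0)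
    {t : ℝ} (ht : 0 ≤ t) {f : ℝ → ℝ} (hf : MemLpLoc b q f) (n : ℕ) :
    locLpSeminorm b q n (T t f) ≤ locLpSeminorm b q n f := by
  rw [seminorm_eq hq (memLp_of_loc hq hf n), 
    seminorm_eq hq (memLp_of_loc hq (T_mem hq hT ht hf) n)]
  refine ENNReal.toReal_mono (memLp_of_loc hq hf n).2.ne ?_
  rw [eLpNorm_congr_ae (T_ae hT ht f n)]
  refine (eLpNorm_mono_measure _ Measure.restrict_le_self).trans ?_
  rw [eLpNorm_comp_measurePreserving (memLp_ind hq hf n).1 (mp_add t),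
    eLpNorm_indicator_eq_eLpNorm_restrict measurableSet_Icc]

/-- reduction of seminorm convergence to global `eLpNorm` convergence -/
lemma seminorm_tendsto (hq : 1 < q) {n : ℕ} {l : Filter ℝ} {u v : ℝ → ℝ → ℝ}
    (hu : ∀ᶠ h in l, MemLp (u h) (ENNReal.ofReal q) (volume.restrict (Icc (-(n : ℝ)) b)))
    (huv : ∀ᶠ h in l, u h =ᵐ[volume.restrict (Icc (-(n : ℝ)) b)] v h)
    (hv : Tendsto (fun h => eLpNorm (v h) (ENNReal.ofReal q) volume) l (𝓝 0)) :
    Tendsto (fun h => locLpSeminorm b q n (u h)) l (𝓝 0) := by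
  have h1 : Tendsto (fun h => eLpNorm (u h) (ENNReal.ofReal q)
      (volume.restrict (Icc (-(n : ℝ)) b))) l (𝓝 0) := by
    refine tendsto_of_tendsto_of_tendsto_of_le_of_le' tendsto_const_nhds hv
      (Eventually.of_forall fun _ => zero_le) ?_
    filter_upwards [huv] with h hh
    rw [eLpNorm_congr_ae hh]
    exact eLpNorm_mono_measure _ Measure.restrict_le_self
  have h2 := (ENNReal.tendsto_toReal ENNReal.zero_ne_top).comp h1
  rw [ENNReal.toReal_zero] at h2
  refine h2.congr' ?_
  filter_upwards [hu] with h hh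
  exact (seminorm_eq hq hh).symm

lemma T_cont (hq : 1 < q)
    (hT : ∀ (t : ℝ) (f : ℝ → ℝ) (s : ℝ), T t f s = if s + t ≤ b then f (s + t) else 0)
    {f : ℝ → ℝ} (hf : MemLpLoc b q f) {r : ℝ} (hr : 0 ≤ r) (n : ℕ) :
    Tendsto (fun t : ℝ => locLpSeminorm b q n (T t f - T r f)) (𝓝[Ici (0 : ℝ)] r) (𝓝 0) := by
  refine seminorm_tendsto hq ?_ ?_
    ((translation_cont hq (memLp_ind hq hf n) r).mono_left nhdsWithin_le_nhds)
  · filter_upwards [self_mem_nhdsWithin] with t ht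
    exact (memLp_of_loc hq (T_mem hq hT ht hf) n).sub (memLp_of_loc hq (T_mem hq hT hr hf) n)
  · filter_upwards [self_mem_nhdsWithin] with t ht
    exact (T_ae hT ht f n).sub (T_ae hT hr f n)

lemma quot_mem (hq : 1 < q)
    (hT : ∀ (t : ℝ) (f : ℝ → ℝ) (s : ℝ), T t f s = if s + t ≤ b then f (s + t) else 0)
    {x d : ℝ → ℝ} (hx : MemLpLoc b q x) (hd : MemLpLoc b q d) {h : ℝ} (hh : 0 ≤ h) (n : ℕ) :
    MemLp (fun s : ℝ => h⁻¹ * (T h x s - x s) - d s) (ENNReal.ofReal q)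
      (volume.restrict (Icc (-(n : ℝ)) b)) :=
  (((memLp_of_loc hq (T_mem hq hT hh hx) n).sub (memLp_of_loc hq hx n)).const_mul h⁻¹).sub
    (memLp_of_loc hq hd n)

lemma gen_one (hq : 1 < q)
    (hT : ∀ (t : ℝ) (f : ℝ → ℝ) (s : ℝ), T t f s = if s + t ≤ b then f (s + t) else 0)
    {x y d : ℝ → ℝ} (hx : MemLpLoc b q x) (hd : MemLpLoc b q d)
    (hxy : x =ᵐ[volume.restrict (Iic b)] y)
    (hy : ∀ s t : ℝ, s ≤ t → t ≤ b → y t - y s = ∫ r in s..t, d r) (hyb : y b = 0) (n : ℕ) :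
    Tendsto (fun h : ℝ => locLpSeminorm b q n (fun s : ℝ => h⁻¹ * (T h x s - x s) - d s))
        (𝓝[>] (0 : ℝ)) (𝓝 0) := by
  set D : ℝ → ℝ := indicator (Icc (-(n : ℝ)) b) d with hDdef
  have hDm : MemLp D (ENNReal.ofReal q) volume := memLp_ind hq hd n
  obtain ⟨D', hD'm, hD'⟩ := hDm.1
  have hD'L : MemLp D' (ENNReal.ofReal q) volume := (memLp_congr_ae hD').1 hDm
  refine seminorm_tendsto hq ?_ ?_ (avg_tendsto hq hD'm.measurable hD'L)
  · filter_upwards [self_mem_nhdsWithin] with h hh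
    exact quot_mem hq hT hx hd (le_of_lt hh) n
  · filter_upwards [self_mem_nhdsWithin] with h hh
    have hh : 0 < h := hh
    have a1 : ∀ᵐ s : ℝ, s ∈ Iic b → x s = y s := (ae_restrict_iff' measurableSet_Iic).1 hxy
    have a2 : ∀ᵐ s : ℝ, s + h ∈ Iic b → x (s + h) = y (s + h) :=
      (mp_add h).quasiMeasurePreserving.ae a1
    rw [Filter.EventuallyEq, ae_restrict_iff' measurableSet_Icc]
    filter_upwards [a1, a2, hD'] with s h1 h2 h3 hs
    have hDint := ind_int hq hd n
    have hD'int : IntervalIntegrable D' volume s (s + h) :=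
      (hDint s (s + h)).congr_ae (ae_restrict_of_ae hD')
    have i1 : ∫ r in (0 : ℝ)..h, (D' (s + r) - D' s) = (∫ r in s..(s + h), D r) - h * d s := by
      have c1 : IntervalIntegrable (fun r => D' (s + r)) volume 0 h := by
        simpa using hD'int.comp_add_left s
      rw [intervalIntegral.integral_sub c1 (by simp), intervalIntegral.integral_const,
        intervalIntegral.integral_comp_add_left (fun r => D' r) s, ← h3, hDdef,
        indicator_of_mem hs]
      simp only [add_zero, sub_zero, smul_eq_mul]
      congr 1
      refine intervalIntegral.integral_congr_ae ?_
      filter_upwards [hD'] with u hu _ using hu.symm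
    have sub : ∀ t, s ≤ t → t ≤ b → ∫ r in s..t, D r = ∫ r in s..t, d r := by
      intro t hst htb
      refine intervalIntegral.integral_congr fun u hu => ?_
      rw [uIcc_of_le hst] at hu
      have hm : u ∈ Icc (-(n : ℝ)) b := ⟨hs.1.trans hu.1, hu.2.trans htb⟩
      exact indicator_of_mem hm _
    have i2 : T h x s - x s = ∫ r in s..(s + h), D r := by
      rw [hT, h1 hs.2]
      split_ifs with hc
      · rw [h2 hc, sub _ (by linarith) hc, hy _ _ (by linarith) hc]
      · rw [← intervalIntegral.integral_add_adjacent_intervals (hDint s b) (hDint b (s + h)),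
          sub b hs.2 le_rfl, ← hy s b hs.2 le_rfl, hyb]
        have : ∫ r in b..(s + h), D r = 0 := by
          apply intervalIntegral.integral_zero_ae
          refine Eventually.of_forall fun u hu => ?_
          rw [uIoc_of_le (by linarith)] at hu
          exact indicator_of_notMem (fun h => absurd h.2 (not_le.2 hu.1)) _
        rw [this]; ring
    rw [i1, i2]
    field_simp

lemma gen_two (hq : 1 < q)
    (hT : ∀ (t : ℝ) (f : ℝ → ℝ) (s : ℝ), T t f s = if s + t ≤ b then f (s + t) else 0)
    {x g : ℝ → ℝ} (hx : MemLpLoc b q x) (hg : MemLpLoc b q g)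
    (hlim : ∀ n : ℕ, Tendsto (fun h : ℝ =>
          locLpSeminorm b q n (fun s : ℝ => h⁻¹ * (T h x s - x s) - g s))
        (𝓝[>] (0 : ℝ)) (𝓝 0)) :
    x =ᵐ[volume.restrict (Iic b)] fun s => -∫ r in s..b, g r := by
  have a1 : ∀ n : ℕ, ∀ᵐ s : ℝ, ∀ c, HasDerivAt
      (fun u => ∫ t in c..u, indicator (Icc (-(n : ℝ)) b) x t)
      (indicator (Icc (-(n : ℝ)) b) x s) s := fun n => 
    _root_.LocallyIntegrable.ae_hasDerivAt_integral (ind_loc hq hx n)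
  rw [Filter.EventuallyEq, ae_restrict_iff' measurableSet_Iic]
  filter_upwards [ae_all_iff.2 a1] with s hs hsb
  have hsb : s ≤ b := hsb
  obtain ⟨n, hn⟩ := exists_nat_ge (-s)
  have hsI : s ∈ Icc (-(n : ℝ)) b := ⟨by linarith, hsb⟩
  set X : ℝ → ℝ := indicator (Icc (-(n : ℝ)) b) x with hX
  have hXint := ind_int hq hx n
  have l1 := (hs n s).tendsto_slope_zero_right
  rw [← hX] at l1
  simp only [intervalIntegral.integral_same, sub_zero, smul_eq_mul] at l1
  have hXs : X s = x s := indicator_of_mem hsI _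
  rw [hXs] at l1
  set u : ℝ → ℝ → ℝ := fun h s => h⁻¹ * (T h x s - x s) - g s with hu
  have id1 : ∀ h, 0 < h → ∫ r in s..b, u h r =
      -(h⁻¹ * ∫ t in s..(s + h), X t) - ∫ r in s..b, g r := by
    intro h hh
    have c1 : IntervalIntegrable (fun r => X (r + h)) volume s b := by
      simpa using (hXint (s + h) (b + h)).comp_add_right h
    have e1 : ∫ r in s..b, u h r = ∫ r in s..b, (h⁻¹ * (X (r + h) - X r) - g r) := by
      refine intervalIntegral.integral_congr fun r hr => ?_
      rw [uIcc_of_le hsb] at hr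
      have hrI : r ∈ Icc (-(n : ℝ)) b := ⟨hsI.1.trans hr.1, hr.2⟩
      have hXr : X r = x r := indicator_of_mem hrI _
      simp only [hu, T_eq hT hh.le x hrI, hXr, ← hX]
    rw [e1, intervalIntegral.integral_sub ((c1.sub (hXint s b)).const_mul _)
      (intInt hq hg hsb le_rfl), intervalIntegral.integral_const_mul,
      intervalIntegral.integral_sub c1 (hXint s b),
      intervalIntegral.integral_comp_add_right (fun r => X r) h]
    have z : ∫ r in b..(b + h), X r = 0 := by
      apply intervalIntegral.integral_zero_ae
      refine Eventually.of_forall fun u hu => ?_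
      rw [uIoc_of_le (by linarith)] at hu
      exact indicator_of_notMem (fun h => absurd h.2 (not_le.2 hu.1)) _
    have k1 := intervalIntegral.integral_add_adjacent_intervals (hXint s (s + h))
      (hXint (s + h) (b + h))
    have k2 := intervalIntegral.integral_add_adjacent_intervals (hXint s b) (hXint b (b + h))
    have : (∫ r in (s + h)..(b + h), X r) - ∫ r in s..b, X r = -∫ r in s..(s + h), X r := by
      linarith
    rw [this]; ring
  have l2 : Tendsto (fun h => ∫ r in s..b, u h r) (𝓝[>] (0 : ℝ))
      (𝓝 (-x s - ∫ r in s..b, g r)) := by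
    refine (l1.neg.sub_const _).congr' ?_
    filter_upwards [self_mem_nhdsWithin] with h hh
    rw [id1 h hh]
  set μ := volume.restrict (Icc (-(n : ℝ)) b) with hμ
  have : IsFiniteMeasure μ := by rw [hμ]; infer_instance
  set C : ENNReal := μ univ ^ (1 / (1 : ENNReal).toReal - 1 / (ENNReal.ofReal q).toReal) with hC
  have hCt : C ≠ ⊤ := by
    refine ENNReal.rpow_ne_top_of_nonneg ?_ (measure_ne_top _ _)
    rw [ENNReal.toReal_ofReal (by linarith), ENNReal.toReal_one, sub_nonneg]
    gcongr
  have l3 : Tendsto (fun h => ∫ r in s..b, u h r) (𝓝[>] (0 : ℝ)) (𝓝 0) := by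
    have hl := (hlim n).mul_const C.toReal
    rw [zero_mul] at hl
    refine squeeze_zero_norm' ?_ hl
    filter_upwards [self_mem_nhdsWithin] with h hh
    have hm := quot_mem hq hT hx hg (le_of_lt hh) n
    have hm1 : MemLp (u h) 1 μ := hm.mono_exponent (by simp; linarith)
    change ‖∫ r in s..b, u h r‖ ≤ locLpSeminorm b q n (u h) * C.toReal
    rw [seminorm_eq hq hm, ← ENNReal.toReal_mul]
    have e := eLpNorm_le_eLpNorm_mul_rpow_measure_univ (p := 1) (q := ENNReal.ofReal q)
      (by simp; linarith) hm.1
    refine le_trans ?_ (ENNReal.toReal_mono (ENNReal.mul_ne_top hm.2.ne hCt) e)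
    rw [intervalIntegral.integral_of_le hsb]
    refine (norm_integral_le_lintegral_norm _).trans ?_
    refine ENNReal.toReal_mono hm1.2.ne ?_
    rw [eLpNorm_one_eq_lintegral_enorm]
    simp only [ofReal_norm]
    exact lintegral_mono' (Measure.restrict_mono
      (Ioc_subset_Icc_self.trans (Icc_subset_Icc_left hsI.1)) le_rfl) le_rfl
  have := tendsto_nhds_unique l2 l3
  linarith

end

end DS

/-- The **left-shift semigroup on `X = L^p_loc((-∞,b])`** (Example, part 1).  Everything is
phrased at the level of representative functions `ℝ → ℝ` (only behaviour on `(-∞,b]`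
matters), with the topology of `X` expressed through the seminorms
`p_n(f) = (∫_{-n}^b |f|^p)^{1/p}`.  The semigroup `(T t x)(s) = x (s+t)` for `s + t ≤ b`,
`= 0` for `s + t > b`, is an equicontinuous `C₀`-semigroup on `X` with
`p_n(T t x) ≤ p_n(x)`, and its generator is `A x = x'` with domain
`D(A) = {x ∈ W^{1,p}_loc((-∞,b]) : x(b) = 0}` (membership in `W^{1,p}_loc` with boundary
value `0` is expressed by the existence of a representative `y` which is an indefinite
integral of a function `d ∈ L^p_loc` with `y b = 0`). -/
theorem left_shift_semigroup_on_Lp_loc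
    (b : ℝ) (hb : 0 < b) (q : ℝ) (hq : 1 < q)
    (T : ℝ → (ℝ → ℝ) → ℝ → ℝ)
    (hT : ∀ (t : ℝ) (f : ℝ → ℝ) (s : ℝ), T t f s = if s + t ≤ b then f (s + t) else 0) :
    -- `T t` maps `X` into `X` and `p_n(T t x) ≤ p_n(x)` (equicontinuity)
    (∀ t : ℝ, 0 ≤ t → ∀ f : ℝ → ℝ, MemLpLoc b q f → MemLpLoc b q (T t f) ∧
      ∀ n : ℕ, locLpSeminorm b q n (T t f) ≤ locLpSeminorm b q n f) ∧
    -- `T 0 = id` (on `(-∞,b]`)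
    (∀ (f : ℝ → ℝ) (s : ℝ), s ≤ b → T 0 f s = f s) ∧
    -- `T (t+s) = T t ∘ T s`
    (∀ t s : ℝ, 0 ≤ t → 0 ≤ s → ∀ (f : ℝ → ℝ) (u : ℝ),
      T (t + s) f u = T t (T s f) u) ∧
    -- strong continuity, in the seminorm topology of `X`
    (∀ f : ℝ → ℝ, MemLpLoc b q f → ∀ r₀ : ℝ, 0 ≤ r₀ → ∀ n : ℕ,
      Tendsto (fun t : ℝ => locLpSeminorm b q n (T t f - T r₀ f))
        (𝓝[Ici (0 : ℝ)] r₀) (𝓝 0)) ∧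
    -- generator, part 1: every `x ∈ D(A)` is in the domain of the generator, with value `x'`
    (∀ x y d : ℝ → ℝ, MemLpLoc b q x → MemLpLoc b q d →
      x =ᵐ[volume.restrict (Iic b)] y →
      (∀ s t : ℝ, s ≤ t → t ≤ b → y t - y s = ∫ r in s..t, d r) →
      y b = 0 →
      ∀ n : ℕ, Tendsto (fun h : ℝ =>
          locLpSeminorm b q n (fun s : ℝ => h⁻¹ * (T h x s - x s) - d s))
        (𝓝[>] (0 : ℝ)) (𝓝 0)) ∧
    -- generator, part 2: the domain of the generator is contained in `D(A)`
    (∀ x g : ℝ → ℝ, MemLpLoc b q x → MemLpLoc b q g →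
      (∀ n : ℕ, Tendsto (fun h : ℝ =>
          locLpSeminorm b q n (fun s : ℝ => h⁻¹ * (T h x s - x s) - g s))
        (𝓝[>] (0 : ℝ)) (𝓝 0)) →
      ∃ y : ℝ → ℝ, x =ᵐ[volume.restrict (Iic b)] y ∧
        (∀ s t : ℝ, s ≤ t → t ≤ b → y t - y s = ∫ r in s..t, g r) ∧ y b = 0) := by
  refine ⟨fun t ht f hf => ⟨T_mem hq hT ht hf, T_le hq hT ht hf⟩, ?_, ?_,
    fun f hf r hr n => T_cont hq hT hf hr n,
    fun x y d hx hd hxy hy hyb n => gen_one hq hT hx hd hxy hy hyb n, ?_⟩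
  · intro f s hs
    simp [hT, hs]
  · intro t s ht hs f u
    rw [hT, hT, hT]
    have e : u + (t + s) = u + t + s := by ring
    rw [e]
    by_cases h1 : u + t + s ≤ b
    · rw [if_pos h1, if_pos (by linarith)]
    · simp [h1]
  · intro x g hx hg hlim
    refine ⟨fun s => -∫ r in s..b, g r, gen_two hq hT hx hg hlim, fun s t hst htb => ?_, by simp⟩
    have := intervalIntegral.integral_add_adjacent_intervals (intInt hq hg hst htb)
      (intInt hq hg htb le_rfl)
    simp only
    linarith
end

section
/- Let b > 0 and 1 < p < ∞, let X = L^p_loc((−∞,b]) be the Fréchet space with seminorms p_n(x) = (∫_{−n}^b |x|^p dt)^{1/p}, n ∈ ℕ, and let Φ : X → ℝ be a continuous linear functional satisfying |Φ(x)| ≤ K p₁(x) for some K > 0 and all x ∈ X. Then the operator C : D(C) → X defined by C x = x′ on D(C) = {x ∈ W^{1,p}_loc((−∞,b]) : x(b) = Φ(x)} generates a locally equicontinuous C₀-semigroup on X. -/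
open MeasureTheory Set Filter Topology

open DS

namespace DSAux

open scoped ENNReal

/-- `u` is measurable and in `L^q` on every compact interval. -/
def LL (q : ℝ) (u : ℝ → ℝ) : Prop :=
  AEStronglyMeasurable u volume ∧
    ∀ a c : ℝ, MemLp u (ENNReal.ofReal q) (volume.restrict (Icc a c))

lemma memLpLoc_iff {b q : ℝ} (hq : 1 < q) {f : ℝ → ℝ} :
    MemLpLoc b q f ↔ AEStronglyMeasurable f (volume.restrict (Iic b)) ∧
      ∀ n : ℕ, MemLp f (ENNReal.ofReal q) (volume.restrict (Icc (-(n : ℝ)) b)) := by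
  unfold MemLpLoc
  refine and_congr_right fun hm => forall_congr' fun n => ?_
  have hm' : AEStronglyMeasurable f (volume.restrict (Icc (-(n : ℝ)) b)) :=
    hm.mono_measure (Measure.restrict_mono Icc_subset_Iic_self le_rfl)
  have := integrable_norm_rpow_iff (p := ENNReal.ofReal q) hm'
    (by simp; linarith) (by simp)
  rw [ENNReal.toReal_ofReal (by linarith)] at this
  simpa [IntegrableOn, Real.norm_eq_abs] using this

lemma MemLpLoc.memLp {b q : ℝ} (hq : 1 < q) {f : ℝ → ℝ} (hf : MemLpLoc b q f) (a : ℝ) :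
    MemLp f (ENNReal.ofReal q) (volume.restrict (Icc a b)) := by
  obtain ⟨n, hn⟩ := exists_nat_gt (-a)
  exact (((memLpLoc_iff hq).1 hf).2 n).mono_measure
    (Measure.restrict_mono (Icc_subset_Icc (by linarith) le_rfl) le_rfl)

lemma seminorm_eq {b q : ℝ} (hq : 1 < q) {f : ℝ → ℝ} {n : ℕ}
    (hf : MemLp f (ENNReal.ofReal q) (volume.restrict (Icc (-(n : ℝ)) b))) :
    locLpSeminorm b q n f =
      (eLpNorm f (ENNReal.ofReal q) (volume.restrict (Icc (-(n : ℝ)) b))).toReal := by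
  rw [hf.eLpNorm_eq_integral_rpow_norm (by simp; linarith) (by simp),
    ENNReal.toReal_ofReal (by positivity), ENNReal.toReal_ofReal (by linarith)]
  simp [locLpSeminorm, Real.norm_eq_abs]

lemma seminorm_nonneg (b q : ℝ) (n : ℕ) (f : ℝ → ℝ) : 0 ≤ locLpSeminorm b q n f := by
  unfold locLpSeminorm
  exact Real.rpow_nonneg (integral_nonneg fun t => by positivity) _

lemma LL.memLpLoc {q : ℝ} (hq : 1 < q) {u : ℝ → ℝ} (hu : LL q u) (b : ℝ) : MemLpLoc b q u :=
  (memLpLoc_iff hq).2 ⟨hu.1.restrict, fun _ => hu.2 _ _⟩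

lemma LL.add {q : ℝ} {u v : ℝ → ℝ} (hu : LL q u) (hv : LL q v) : LL q (u + v) :=
  ⟨hu.1.add hv.1, fun a c => (hu.2 a c).add (hv.2 a c)⟩

lemma LL.sub {q : ℝ} {u v : ℝ → ℝ} (hu : LL q u) (hv : LL q v) : LL q (u - v) :=
  ⟨hu.1.sub hv.1, fun a c => (hu.2 a c).sub (hv.2 a c)⟩

lemma LL.smul {q : ℝ} {u : ℝ → ℝ} (r : ℝ) (hu : LL q u) : LL q (r • u) :=
  ⟨hu.1.const_smul r, fun a c => (hu.2 a c).const_smul r⟩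

lemma mp_shift (a c t : ℝ) : MeasurePreserving (fun s : ℝ => s + t)
    (volume.restrict (Icc a c)) (volume.restrict (Icc (a + t) (c + t))) := by
  have h := (measurePreserving_add_right (volume : Measure ℝ) t).restrict_preimage
    (s := Icc (a + t) (c + t)) measurableSet_Icc
  simpa using h

lemma eLpNorm_shift {p : ℝ≥0∞} {u : ℝ → ℝ} (hu : AEStronglyMeasurable u volume) (a c t : ℝ) :
    eLpNorm (fun s => u (s + t)) p (volume.restrict (Icc a c)) =
      eLpNorm u p (volume.restrict (Icc (a + t) (c + t))) :=
  eLpNorm_comp_measurePreserving hu.restrict (mp_shift a c t)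

lemma LL.shift {q : ℝ} {u : ℝ → ℝ} (hu : LL q u) (t : ℝ) : LL q (fun s => u (s + t)) :=
  ⟨hu.1.comp_measurePreserving (measurePreserving_add_right (volume : Measure ℝ) t),
    fun a c => (hu.2 (a + t) (c + t)).comp_measurePreserving (mp_shift a c t)⟩

lemma LL.of_continuous {q : ℝ} {u : ℝ → ℝ} (hu : Continuous u) : LL q u := by
  refine ⟨hu.aestronglyMeasurable, fun a c => ?_⟩
  obtain ⟨C, hC⟩ := isCompact_Icc.exists_bound_of_continuousOn (hu.continuousOn (s := Icc a c))
  exact MemLp.of_bound hu.aestronglyMeasurable C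
    ((ae_restrict_iff' measurableSet_Icc).2 (Eventually.of_forall hC))

lemma LL.integrableOn {q : ℝ} (hq : 1 < q) {u : ℝ → ℝ} (hu : LL q u) (a c : ℝ) :
    IntegrableOn u (Icc a c) volume :=
  (hu.2 a c).integrable (by simpa using hq.le)

lemma LL.intervalIntegrable {q : ℝ} (hq : 1 < q) {u : ℝ → ℝ} (hu : LL q u) (a c : ℝ) :
    IntervalIntegrable u volume a c :=
  intervalIntegrable_iff.2 ((hu.integrableOn hq _ _).mono_set uIoc_subset_uIcc)

lemma LL.locallyIntegrable {q : ℝ} (hq : 1 < q) {u : ℝ → ℝ} (hu : LL q u) :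
    LocallyIntegrable u volume := by
  intro x
  exact ⟨Icc (x - 1) (x + 1), Icc_mem_nhds (by linarith) (by linarith), hu.integrableOn hq _ _⟩

/-- Continuity of translations. -/
lemma LL.tendsto_shift {q : ℝ} (hq : 1 < q) {u : ℝ → ℝ} (hu : LL q u) (a c t₀ : ℝ) :
    Tendsto (fun t => eLpNorm (fun s => u (s + t) - u (s + t₀)) (ENNReal.ofReal q)
      (volume.restrict (Icc a c))) (𝓝 t₀) (𝓝 0) := by
  have : Fact (1 ≤ ENNReal.ofReal q) := ⟨by simpa using hq.le⟩
  set A := Icc (a - |t₀| - 1) (c + |t₀| + 1) with hA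
  have hU : MemLp (A.indicator u) (ENNReal.ofReal q) volume :=
    (memLp_indicator_iff_restrict measurableSet_Icc).2 (hu.2 _ _)
  let g0 : C(ℝ, C(ℝ, ℝ)) := (ContinuousMap.mk (fun z : ℝ × ℝ => z.2 + z.1) (by fun_prop)).curry
  have hmp : ∀ t, MeasurePreserving (g0 t) (volume : Measure ℝ) volume := fun t =>
    measurePreserving_add_right (volume : Measure ℝ) t
  have key := Filter.Tendsto.compMeasurePreservingLp (l := 𝓝 t₀) (f := fun _ : ℝ => hU.toLp _)
    (f₀ := hU.toLp _) tendsto_const_nhds g0.continuous.continuousAt hmp (hmp t₀) (by simp)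
  rw [tendsto_iff_edist_tendsto_0] at key
  simp only [Lp.toLp_compMeasurePreserving, Lp.edist_toLp_toLp] at key
  refine tendsto_of_tendsto_of_tendsto_of_le_of_le' tendsto_const_nhds key
    (Eventually.of_forall fun _ => zero_le) ?_
  filter_upwards [Metric.ball_mem_nhds t₀ one_pos] with t ht
  refine le_trans (le_of_eq ?_) (eLpNorm_mono_measure _ (Measure.restrict_le_self (s := Icc a c)))
  refine eLpNorm_congr_ae ((ae_restrict_iff' measurableSet_Icc).2 (Eventually.of_forall ?_))
  intro s hs
  rw [Metric.mem_ball, Real.dist_eq, abs_lt] at ht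
  have h1 : s + t ∈ A := ⟨by have := neg_abs_le t₀; linarith [hs.1], by
    have := le_abs_self t₀; linarith [hs.2]⟩
  have h2 : s + t₀ ∈ A := ⟨by have := neg_abs_le t₀; linarith [hs.1], by
    have := le_abs_self t₀; linarith [hs.2]⟩
  have e1 : g0 t s = s + t := rfl
  have e2 : g0 t₀ s = s + t₀ := rfl
  simp [e1, e2, indicator_of_mem h1, indicator_of_mem h2]

lemma diffq_bound {q : ℝ} (hq : 1 < q) {D Y : ℝ → ℝ} (hDm : Measurable D) (hD : LL q D)
    (hY : ∀ s t, Y t - Y s = ∫ r in s..t, D r) {a c h : ℝ} (hh : 0 < h) {ε : ℝ≥0∞}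
    (hε : ∀ r ∈ Ioc 0 h, eLpNorm (fun s => D (s + r) - D s) (ENNReal.ofReal q)
      (volume.restrict (Icc a c)) ≤ ε) :
    eLpNorm (fun s => h⁻¹ * (Y (s + h) - Y s) - D s) (ENNReal.ofReal q)
      (volume.restrict (Icc a c)) ≤ ε := by
  have hq0 : 0 < q := by linarith
  have hp0 : ENNReal.ofReal q ≠ 0 := by simp; linarith
  have hpt : ENNReal.ofReal q ≠ ⊤ := by simp
  have hpr : (ENNReal.ofReal q).toReal = q := ENNReal.toReal_ofReal hq0.le
  set ν : Measure ℝ := (ENNReal.ofReal h)⁻¹ • volume.restrict (Ioc 0 h) with hν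
  have hνp : IsProbabilityMeasure ν := by
    constructor
    simp [hν, ENNReal.inv_mul_cancel, hh]
  have hνae : ∀ᵐ r ∂ν, r ∈ Ioc 0 h :=
    Measure.ae_smul_measure (ae_restrict_mem measurableSet_Ioc) _
  have hF : Measurable (fun z : ℝ × ℝ => D (z.1 + z.2) - D z.1) := by fun_prop
  have pt : ∀ s, ‖h⁻¹ * (Y (s + h) - Y s) - D s‖ₑ ^ q ≤
      ∫⁻ r, ‖D (s + r) - D s‖ₑ ^ q ∂ν := by
    intro s
    have hsm : AEStronglyMeasurable (fun r => D (s + r) - D s) ν := by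
      apply Measurable.aestronglyMeasurable; fun_prop
    have e : h⁻¹ * (Y (s + h) - Y s) - D s = ∫ r, (D (s + r) - D s) ∂ν := by
      rw [hν, integral_smul_measure, ← intervalIntegral.integral_of_le hh.le,
        intervalIntegral.integral_sub, intervalIntegral.integral_comp_add_left, hY]
      · simp [ENNReal.toReal_inv, ENNReal.toReal_ofReal hh.le, mul_sub, hh.ne']
      · have := (hD.shift s).intervalIntegrable hq 0 h
        simpa [add_comm] using this
      · simp
    have b1 : ‖h⁻¹ * (Y (s + h) - Y s) - D s‖ₑ ≤
        eLpNorm (fun r => D (s + r) - D s) (ENNReal.ofReal q) ν := by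
      rw [e]
      refine (enorm_integral_le_lintegral_enorm _).trans ?_
      rw [← eLpNorm_one_eq_lintegral_enorm]
      exact eLpNorm_le_eLpNorm_of_exponent_le (by simpa using hq.le) hsm
    rw [eLpNorm_eq_lintegral_rpow_enorm_toReal hp0 hpt, hpr, one_div] at b1
    exact (ENNReal.le_rpow_inv_iff hq0).1 b1
  rw [eLpNorm_eq_lintegral_rpow_enorm_toReal hp0 hpt, hpr, one_div, ENNReal.rpow_inv_le_iff hq0]
  calc _ ≤ ∫⁻ s in Icc a c, ∫⁻ r, ‖D (s + r) - D s‖ₑ ^ q ∂ν := lintegral_mono fun s => pt s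
    _ = ∫⁻ r, (∫⁻ s in Icc a c, ‖D (s + r) - D s‖ₑ ^ q) ∂ν := by
      apply lintegral_lintegral_swap
      apply Measurable.aemeasurable
      exact (hF.enorm).pow_const q
    _ ≤ ∫⁻ r, ε ^ q ∂ν := by
      refine lintegral_mono_ae ?_
      filter_upwards [hνae] with r hr
      have := hε r hr
      rw [eLpNorm_eq_lintegral_rpow_enorm_toReal hp0 hpt, hpr,
        one_div, ENNReal.rpow_inv_le_iff hq0] at this
      exact this
    _ = ε ^ q := by simp

lemma LL.congr {q : ℝ} {u v : ℝ → ℝ} (hu : LL q u) (h : u =ᵐ[volume] v) : LL q v :=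
  ⟨hu.1.congr h, fun a c => (memLp_congr_ae (ae_restrict_of_ae h)).1 (hu.2 a c)⟩

/-- Difference quotients of a primitive converge locally in `L^q`. -/
lemma tendsto_diffq {q : ℝ} (hq : 1 < q) {D Y : ℝ → ℝ} (hD : LL q D)
    (hY : ∀ s t, Y t - Y s = ∫ r in s..t, D r) (a c : ℝ) :
    Tendsto (fun h => eLpNorm (fun s => h⁻¹ * (Y (s + h) - Y s) - D s) (ENNReal.ofReal q)
      (volume.restrict (Icc a c))) (𝓝[>] 0) (𝓝 0) := by
  set D' := hD.1.aemeasurable.mk D with hD'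
  have hDD : D =ᵐ[volume] D' := hD.1.aemeasurable.ae_eq_mk
  have hm : Measurable D' := hD.1.aemeasurable.measurable_mk
  have hL : LL q D' := hD.congr hDD
  have hY' : ∀ s t, Y t - Y s = ∫ r in s..t, D' r := fun s t => by
    rw [hY s t]
    exact intervalIntegral.integral_congr_ae (hDD.mono fun x hx _ => hx)
  have e : ∀ h : ℝ, eLpNorm (fun s => h⁻¹ * (Y (s + h) - Y s) - D s) (ENNReal.ofReal q)
      (volume.restrict (Icc a c)) = eLpNorm (fun s => h⁻¹ * (Y (s + h) - Y s) - D' s)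
      (ENNReal.ofReal q) (volume.restrict (Icc a c)) := fun h =>
    eLpNorm_congr_ae ((ae_restrict_of_ae hDD).mono fun x hx => by simp [hx])
  simp only [e]
  rw [ENNReal.tendsto_nhds_zero]
  intro ε hε
  have := ENNReal.tendsto_nhds_zero.1 (hL.tendsto_shift hq a c 0) ε hε
  obtain ⟨δ, hδ, H⟩ := Metric.eventually_nhds_iff.1 this
  filter_upwards [Ioo_mem_nhdsGT hδ] with h hh
  refine diffq_bound hq hm hL hY' hh.1 fun r hr => ?_
  have := H (y := r) (by rw [Real.dist_eq, sub_zero, abs_of_pos hr.1]; linarith [hr.2, hh.2])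
  simpa using this

/-- The hypotheses on the data. -/
structure Hyp (b q K : ℝ) (Φ : (ℝ → ℝ) → ℝ) : Prop where
  hb : 0 < b
  hq : 1 < q
  hK : 0 < K
  ae : ∀ f g : ℝ → ℝ, MemLpLoc b q f → MemLpLoc b q g →
      f =ᵐ[volume.restrict (Iic b)] g → Φ f = Φ g
  add : ∀ f g : ℝ → ℝ, MemLpLoc b q f → MemLpLoc b q g → Φ (f + g) = Φ f + Φ g
  smul : ∀ (c : ℝ) (f : ℝ → ℝ), MemLpLoc b q f → Φ (c • f) = c * Φ f
  bound : ∀ f : ℝ → ℝ, MemLpLoc b q f → |Φ f| ≤ K * locLpSeminorm b q 1 f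

/-- The exponential rate. -/
noncomputable def lam (q K : ℝ) : ℝ := (2 * K) ^ q / q

/-- `u` solves the renewal equation with history `f`. -/
structure Sol (b q K : ℝ) (Φ : (ℝ → ℝ) → ℝ) (f u : ℝ → ℝ) : Prop where
  ll : LL q u
  hist : ∀ s ≤ b, u s = f s
  growth : ∃ C, ∀ s, b < s → |u s| ≤ C * Real.exp (lam q K * (s - b))
  eqn : ∀ t, 0 < t → u (b + t) = Φ (fun s => u (s + t))

section
variable {b q K : ℝ} {Φ : (ℝ → ℝ) → ℝ}

lemma Hyp.lam_pos (H : Hyp b q K Φ) : 0 < lam q K := by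
  have := H.hK; have := H.hq
  unfold lam; positivity

lemma Hyp.sub (H : Hyp b q K Φ) {f g : ℝ → ℝ} (hf : LL q f) (hg : LL q g) :
    Φ (f - g) = Φ f - Φ g := by
  have h1 : f - g = f + (-1 : ℝ) • g := by ext; simp [sub_eq_add_neg]
  rw [h1, H.add _ _ (hf.memLpLoc H.hq b) ((hg.smul _).memLpLoc H.hq b),
    H.smul _ _ (hg.memLpLoc H.hq b)]
  ring

lemma seminorm_eq' (hq : 1 < q) {f : ℝ → ℝ} (hf : MemLpLoc b q f) (n : ℕ) :
    locLpSeminorm b q n f =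
      (eLpNorm f (ENNReal.ofReal q) (volume.restrict (Icc (-(n : ℝ)) b))).toReal :=
  seminorm_eq hq (((memLpLoc_iff hq).1 hf).2 n)

lemma seminorm_add_le (hq : 1 < q) {f g : ℝ → ℝ} (hf : LL q f) (hg : LL q g) (n : ℕ) :
    locLpSeminorm b q n (f + g) ≤ locLpSeminorm b q n f + locLpSeminorm b q n g := by
  rw [seminorm_eq hq (hf.2 _ _), seminorm_eq hq (hg.2 _ _), seminorm_eq hq ((hf.add hg).2 _ _),
    ← ENNReal.toReal_add (hf.2 _ _).2.ne (hg.2 _ _).2.ne]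
  exact ENNReal.toReal_mono (ENNReal.add_ne_top.2 ⟨(hf.2 _ _).2.ne, (hg.2 _ _).2.ne⟩)
    (eLpNorm_add_le hf.1.restrict hg.1.restrict (by simpa using hq.le))

lemma LL.indicator {u : ℝ → ℝ} (hu : LL q u) {A : Set ℝ} (hA : MeasurableSet A) :
    LL q (A.indicator u) :=
  ⟨hu.1.indicator hA, fun a c => (hu.2 a c).indicator hA⟩

lemma LL_indicator_Iic (hq : 1 < q) {f : ℝ → ℝ} (hf : MemLpLoc b q f) :
    LL q ((Iic b).indicator f) := by
  refine ⟨(aestronglyMeasurable_indicator_iff measurableSet_Iic).2 hf.1, fun a c => ?_⟩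
  rw [memLp_indicator_iff_restrict measurableSet_Iic, Measure.restrict_restrict measurableSet_Iic]
  exact (MemLpLoc.memLp hq hf a).mono_measure
    (Measure.restrict_mono (show Iic b ∩ Icc a c ⊆ Icc a b from
      fun x hx => ⟨hx.2.1, hx.1⟩) le_rfl)

lemma seminorm_tail (H : Hyp b q K Φ) {d : ℝ → ℝ} {C : ℝ} (hC : 0 ≤ C)
    (h : ∀ s, |d s| ≤ C * Real.exp (lam q K * (s - b))) (t : ℝ) :
    K * locLpSeminorm b q 1 (fun s => d (s + t)) ≤ C / 2 * Real.exp (lam q K * t) := by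
  have hK := H.hK
  have hq := H.hq
  have hb := H.hb
  have hl := H.lam_pos
  have hq0 : 0 < q := by linarith
  set l := lam q K with hl'
  have hm : 0 < q * l := by positivity
  have hql : q * l = (2 * K) ^ q := by rw [hl', lam]; field_simp
  have I1 : ∫ s in Icc (-((1 : ℕ) : ℝ)) b, |d (s + t)| ^ q ≤
      ∫ s in Icc (-((1 : ℕ) : ℝ)) b, (C * Real.exp (l * t)) ^ q * Real.exp (q * l * (s - b)) := by
    refine integral_mono_of_nonneg (Eventually.of_forall fun s => by positivity) ?_
      (Eventually.of_forall fun s => ?_)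
    · exact (Continuous.continuousOn (by fun_prop)).integrableOn_Icc
    · have h1 := Real.rpow_le_rpow (abs_nonneg _) (h (s + t)) hq0.le
      refine h1.trans (le_of_eq ?_)
      have : C * Real.exp (l * (s + t - b)) = C * Real.exp (l * t) * Real.exp (l * (s - b)) := by
        rw [mul_assoc, ← Real.exp_add]; ring_nf
      rw [this, Real.mul_rpow (by positivity) (by positivity), ← Real.exp_mul (l * (s - b))]
      ring_nf
  have I2 : ∫ s in Icc (-((1 : ℕ) : ℝ)) b, Real.exp (q * l * (s - b)) ≤ (q * l)⁻¹ := by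
    rw [integral_Icc_eq_integral_Ioc, ← intervalIntegral.integral_of_le (by push_cast; linarith)]
    rw [intervalIntegral.integral_eq_sub_of_hasDerivAt
      (f := fun s => Real.exp (q * l * (s - b)) / (q * l))]
    · simp; positivity
    · intro x _
      have := ((((hasDerivAt_id x).sub_const b).const_mul (q * l)).exp).div_const (q * l)
      convert! this using 1
      field_simp; simp
    · exact (Continuous.intervalIntegrable (by fun_prop) _ _)
  rw [integral_const_mul] at I1
  have I3 : locLpSeminorm b q 1 (fun s => d (s + t)) ≤
      C * Real.exp (l * t) * (2 * K)⁻¹ := by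
    unfold locLpSeminorm
    rw [one_div, Real.rpow_inv_le_iff_of_pos (integral_nonneg fun s => by positivity)
      (by positivity) hq0]
    refine I1.trans ?_
    rw [Real.mul_rpow (y := (2 * K)⁻¹) (by positivity) (by positivity), Real.inv_rpow (by positivity), ← hql]
    exact mul_le_mul_of_nonneg_left I2 (by positivity)
  calc _ ≤ K * (C * Real.exp (l * t) * (2 * K)⁻¹) := by gcongr
    _ = _ := by field_simp

lemma seminorm_head (hq : 1 < q) {u f : ℝ → ℝ} (hu : LL q u) (hf : MemLpLoc b q f)
    (huf : ∀ s ≤ b, u s = f s) {t : ℝ} (ht : 0 ≤ t) (n : ℕ) :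
    locLpSeminorm b q n (fun s => (Iic b).indicator u (s + t)) ≤ locLpSeminorm b q n f := by
  have hi := hu.indicator (measurableSet_Iic (a := b))
  rw [seminorm_eq hq ((hi.shift t).2 _ _), seminorm_eq' hq hf]
  refine ENNReal.toReal_mono (((memLpLoc_iff hq).1 hf).2 n).2.ne ?_
  rw [eLpNorm_shift hi.1, eLpNorm_indicator_eq_eLpNorm_restrict measurableSet_Iic,
    Measure.restrict_restrict measurableSet_Iic]
  have : eLpNorm u (ENNReal.ofReal q) (volume.restrict (Iic b ∩ Icc (-(n : ℝ) + t) (b + t))) =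
      eLpNorm f (ENNReal.ofReal q) (volume.restrict (Iic b ∩ Icc (-(n : ℝ) + t) (b + t))) :=
    eLpNorm_congr_ae ((ae_restrict_iff' (by measurability)).2
      (Eventually.of_forall fun s hs => huf s hs.1))
  rw [this]
  exact eLpNorm_mono_measure _ (Measure.restrict_mono
    (show Iic b ∩ Icc (-(n : ℝ) + t) (b + t) ⊆ Icc (-(n : ℝ)) b from
      fun x hx => ⟨by linarith [hx.2.1], hx.1⟩) le_rfl)

lemma split (b : ℝ) (u : ℝ → ℝ) : u = (Iic b).indicator u + (Ioi b).indicator u := by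
  rw [← compl_Iic]; exact (indicator_self_add_compl _ _).symm

lemma tail_bound {u : ℝ → ℝ} {C l : ℝ} (hC : 0 ≤ C)
    (hg : ∀ s, b < s → |u s| ≤ C * Real.exp (l * (s - b))) (s : ℝ) :
    |(Ioi b).indicator u s| ≤ C * Real.exp (l * (s - b)) := by
  by_cases hs : b < s
  · rw [indicator_of_mem (mem_Ioi.2 hs)]; exact hg s hs
  · rw [indicator_of_notMem (by simpa using hs)]; simp; positivity

lemma main_est (H : Hyp b q K Φ) {u f : ℝ → ℝ} (hu : LL q u) (hf : MemLpLoc b q f)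
    (huf : ∀ s ≤ b, u s = f s) {C : ℝ} (hC : 0 ≤ C)
    (hg : ∀ s, b < s → |u s| ≤ C * Real.exp (lam q K * (s - b))) {t : ℝ} (ht : 0 ≤ t) :
    |Φ (fun s => u (s + t))| ≤
      K * locLpSeminorm b q 1 f + C / 2 * Real.exp (lam q K * t) := by
  have h1 := hu.indicator (measurableSet_Iic (a := b))
  have h2 := hu.indicator (measurableSet_Ioi (a := b))
  have e : (fun s => u (s + t)) = (fun s => (Iic b).indicator u (s + t)) +
      (fun s => (Ioi b).indicator u (s + t)) := by
    ext s; exact congrFun (split b u) (s + t)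
  have hK := H.hK
  refine (H.bound _ ((hu.shift t).memLpLoc H.hq b)).trans ?_
  rw [e]
  calc _ ≤ K * (locLpSeminorm b q 1 (fun s => (Iic b).indicator u (s + t)) +
        locLpSeminorm b q 1 (fun s => (Ioi b).indicator u (s + t))) := by
        gcongr; exact seminorm_add_le H.hq (h1.shift t) (h2.shift t) 1
    _ ≤ _ := by
      rw [mul_add]
      refine add_le_add ?_ (seminorm_tail H hC (tail_bound hC hg) t)
      gcongr
      exact seminorm_head H.hq hu hf huf ht 1

lemma Sol.bound (H : Hyp b q K Φ) {u f : ℝ → ℝ} (hf : MemLpLoc b q f) (hS : Sol b q K Φ f u)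
    {s : ℝ} (hs : b < s) :
    |u s| ≤ 2 * K * locLpSeminorm b q 1 f * Real.exp (lam q K * (s - b)) := by
  obtain ⟨C, hC⟩ := hS.growth
  have hK := H.hK
  have hl := H.lam_pos
  have hp := seminorm_nonneg b q 1 f
  have hk : ∀ k : ℕ, ∀ s, b < s → |u s| ≤
      (2 * K * locLpSeminorm b q 1 f + |C| * (1 / 2) ^ k) * Real.exp (lam q K * (s - b)) := by
    intro k
    induction k with
    | zero =>
      intro s hs
      refine (hC s hs).trans ?_
      gcongr
      have := le_abs_self C
      have : 0 ≤ 2 * K * locLpSeminorm b q 1 f := by positivity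
      simp; linarith
    | succ k ih =>
      intro s hs
      have e := hS.eqn (s - b) (by linarith)
      rw [show b + (s - b) = s by ring] at e
      have := main_est H hS.ll hf hS.hist (by positivity) ih (t := s - b) (by linarith)
      rw [e]
      refine this.trans ?_
      have he : 1 ≤ Real.exp (lam q K * (s - b)) :=
        Real.one_le_exp (mul_nonneg hl.le (by linarith))
      have : K * locLpSeminorm b q 1 f ≤
        K * locLpSeminorm b q 1 f * Real.exp (lam q K * (s - b)) :=
        le_mul_of_one_le_right (by positivity) he
      rw [pow_succ]
      linarith
  have hlim : Tendsto (fun k : ℕ => (2 * K * locLpSeminorm b q 1 f + |C| * (1 / 2) ^ k) *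
      Real.exp (lam q K * (s - b))) atTop
      (𝓝 ((2 * K * locLpSeminorm b q 1 f + |C| * 0) * Real.exp (lam q K * (s - b)))) :=
    ((tendsto_pow_atTop_nhds_zero_of_lt_one (by norm_num) (by norm_num)).const_mul _
      |>.const_add _ |>.mul_const _)
  have := ge_of_tendsto' hlim fun k => hk k s hs
  simpa using this

lemma continuous_Phi (H : Hyp b q K Φ) {u : ℝ → ℝ} (hu : LL q u) :
    Continuous fun t => Φ (fun s => u (s + t)) := by
  rw [continuous_iff_continuousAt]
  intro t₀
  rw [ContinuousAt, tendsto_iff_dist_tendsto_zero]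
  have h := (ENNReal.tendsto_toReal ENNReal.zero_ne_top).comp
    (hu.tendsto_shift H.hq (-((1 : ℕ) : ℝ)) b t₀)
  have h' := h.const_mul K
  simp only [ENNReal.toReal_zero, mul_zero] at h'
  refine squeeze_zero (fun _ => dist_nonneg) (fun t => ?_) h'
  rw [Real.dist_eq, ← H.sub (hu.shift t) (hu.shift t₀)]
  have hd := (hu.shift t).sub (hu.shift t₀)
  refine (H.bound _ (hd.memLpLoc H.hq b)).trans (le_of_eq ?_)
  rw [seminorm_eq H.hq (hd.2 _ _)]
  rfl

lemma Sol.exists (H : Hyp b q K Φ) {f : ℝ → ℝ} (hf : MemLpLoc b q f) :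
    ∃ u, Sol b q K Φ f u := by
  have hK := H.hK
  have hl := H.lam_pos
  set l := lam q K with hl'
  let W : (ℝ → ℝ) → ℝ → ℝ := fun v s => Real.exp (l * (s - b)) * v (s - b)
  let U : (ℝ → ℝ) → (ℝ → ℝ) → ℝ → ℝ := fun g v => (Iic b).indicator g + (Ioi b).indicator (W v)
  have hU1 : ∀ g v s, s ≤ b → U g v s = g s := fun g v s hs => by
    simp [U, hs]
  have hU2 : ∀ g v s, b < s → U g v s = Real.exp (l * (s - b)) * v (s - b) := fun g v s hs => by
    simp [U, W, hs]
  have hUL : ∀ g, MemLpLoc b q g → ∀ v : BoundedContinuousFunction ℝ ℝ, LL q (U g v) := by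
    intro g hg v
    refine (LL_indicator_Iic H.hq hg).add (LL.indicator (LL.of_continuous ?_) measurableSet_Ioi)
    have := v.continuous
    fun_prop
  have hUb : ∀ g, ∀ v : BoundedContinuousFunction ℝ ℝ, ∀ s, b < s →
      |U g v s| ≤ ‖v‖ * Real.exp (l * (s - b)) := by
    intro g v s hs
    rw [hU2 _ _ _ hs, abs_mul, abs_of_pos (Real.exp_pos _), mul_comm]
    gcongr
    exact v.norm_coe_le_norm _
  have est : ∀ g, MemLpLoc b q g → ∀ v : BoundedContinuousFunction ℝ ℝ, ∀ t, 0 ≤ t →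
      |Real.exp (-(l * t)) * Φ (fun s => U g v (s + t))| ≤
        K * locLpSeminorm b q 1 g + ‖v‖ / 2 := by
    intro g hg v t ht
    have h1 := main_est H (hUL g hg v) hg (hU1 g v) (norm_nonneg v) (hUb g v) ht
    have hp := seminorm_nonneg b q 1 g
    rw [abs_mul, abs_of_pos (Real.exp_pos _)]
    have he : Real.exp (-(l * t)) ≤ 1 := Real.exp_le_one_iff.2 (by nlinarith)
    calc _ ≤ Real.exp (-(l * t)) * (K * locLpSeminorm b q 1 g + ‖v‖ / 2 * Real.exp (l * t)) := by
          gcongr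
      _ = Real.exp (-(l * t)) * (K * locLpSeminorm b q 1 g) +
          ‖v‖ / 2 * (Real.exp (-(l * t)) * Real.exp (l * t)) := by ring
      _ ≤ 1 * (K * locLpSeminorm b q 1 g) + ‖v‖ / 2 * 1 := by
          rw [← Real.exp_add]; simp only [neg_add_cancel, Real.exp_zero]; gcongr
      _ = _ := by ring
  let F : BoundedContinuousFunction ℝ ℝ → BoundedContinuousFunction ℝ ℝ := fun v =>
    BoundedContinuousFunction.ofNormedAddCommGroup
      (fun t => Real.exp (-(l * max t 0)) * Φ (fun s => U f v (s + max t 0)))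
      (by
        have h1 := (continuous_Phi H (hUL f hf v)).comp
          (continuous_id.max (continuous_const (y := (0 : ℝ))))
        exact Continuous.mul (by fun_prop) h1)
      (K * locLpSeminorm b q 1 f + ‖v‖ / 2)
      (fun t => est f hf v _ (le_max_right _ _))
  have h0 : MemLpLoc b q (0 : ℝ → ℝ) := (LL.of_continuous continuous_zero).memLpLoc H.hq b
  have hs0 : locLpSeminorm b q 1 (0 : ℝ → ℝ) = 0 := by
    rw [seminorm_eq' H.hq h0]; simp
  have hF : ContractingWith (1 / 2) F := by
    refine ⟨by norm_num, LipschitzWith.of_dist_le_mul fun v w => ?_⟩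
    rw [dist_eq_norm, dist_eq_norm]
    refine (BoundedContinuousFunction.norm_le (by positivity)).2 fun t => ?_
    have e : (F v - F w) t = Real.exp (-(l * max t 0)) *
        Φ (fun s => U 0 (v - w : BoundedContinuousFunction ℝ ℝ) (s + max t 0)) := by
      have : (fun s => U 0 (v - w : BoundedContinuousFunction ℝ ℝ) (s + max t 0)) =
          (fun s => U f v (s + max t 0)) - (fun s => U f w (s + max t 0)) := by
        ext s
        simp only [Pi.sub_apply]
        rcases le_or_gt (s + max t 0) b with h | h
        · simp only [hU1 _ _ _ h]; simp
        · simp only [hU2 _ _ _ h]; simp; ring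
      rw [this, H.sub ((hUL f hf v).shift _) ((hUL f hf w).shift _), mul_sub]
      rfl
    rw [e, Real.norm_eq_abs]
    refine (est 0 h0 (v - w) _ (le_max_right _ _)).trans (le_of_eq ?_)
    rw [hs0]; simp; ring
  set v := hF.fixedPoint F
  have hv : F v = v := hF.fixedPoint_isFixedPt
  refine ⟨U f v, hUL f hf v, hU1 f v, ⟨‖v‖, hUb f v⟩, fun t ht => ?_⟩
  rw [hU2 _ _ _ (by linarith), add_sub_cancel_left]
  have : v t = Real.exp (-(l * max t 0)) * Φ (fun s => U f v (s + max t 0)) := by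
    conv_lhs => rw [← hv]
    rfl
  rw [this, max_eq_left ht.le, ← mul_assoc, ← Real.exp_add]
  simp

end

section
variable {b q K : ℝ} {Φ : (ℝ → ℝ) → ℝ}

lemma seminorm_congr {f g : ℝ → ℝ} (h : f =ᵐ[volume.restrict (Iic b)] g) (n : ℕ) :
    locLpSeminorm b q n f = locLpSeminorm b q n g := by
  unfold locLpSeminorm
  congr 1
  refine integral_congr_ae ?_
  have h' : f =ᵐ[volume.restrict (Icc (-(n : ℝ)) b)] g :=
    ae_restrict_of_ae_restrict_of_subset Icc_subset_Iic_self h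
  filter_upwards [h'] with s hs
  rw [hs]

lemma seminorm_mono (hq : 1 < q) {f : ℝ → ℝ} (hf : MemLpLoc b q f) {n m : ℕ} (hnm : n ≤ m) :
    locLpSeminorm b q n f ≤ locLpSeminorm b q m f := by
  rw [seminorm_eq' hq hf, seminorm_eq' hq hf]
  refine ENNReal.toReal_mono (((memLpLoc_iff hq).1 hf).2 m).2.ne
    (eLpNorm_mono_measure _ (Measure.restrict_mono (Icc_subset_Icc ?_ le_rfl) le_rfl))
  have : (n : ℝ) ≤ m := by exact_mod_cast hnm
  linarith

lemma memLpLoc_add (hq : 1 < q) {f g : ℝ → ℝ} (hf : MemLpLoc b q f) (hg : MemLpLoc b q g) :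
    MemLpLoc b q (f + g) := by
  rw [memLpLoc_iff hq] at *
  exact ⟨hf.1.add hg.1, fun n => (hf.2 n).add (hg.2 n)⟩

lemma memLpLoc_smul (hq : 1 < q) {f : ℝ → ℝ} (c : ℝ) (hf : MemLpLoc b q f) :
    MemLpLoc b q (c • f) := by
  rw [memLpLoc_iff hq] at *
  exact ⟨hf.1.const_smul c, fun n => (hf.2 n).const_smul c⟩

lemma Sol.add (H : Hyp b q K Φ) {f g u v : ℝ → ℝ} (hu : Sol b q K Φ f u)
    (hv : Sol b q K Φ g v) : Sol b q K Φ (f + g) (u + v) := by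
  refine ⟨hu.ll.add hv.ll, fun s hs => by simp [hu.hist s hs, hv.hist s hs], ?_, fun t ht => ?_⟩
  · obtain ⟨C, hC⟩ := hu.growth
    obtain ⟨D, hD⟩ := hv.growth
    refine ⟨C + D, fun s hs => ?_⟩
    rw [add_mul]
    exact (abs_add_le _ _).trans (add_le_add (hC s hs) (hD s hs))
  · have := H.add _ _ ((hu.ll.shift t).memLpLoc H.hq b) ((hv.ll.shift t).memLpLoc H.hq b)
    simp only [Pi.add_apply]
    rw [hu.eqn t ht, hv.eqn t ht, ← this]
    rfl

lemma Sol.smul (H : Hyp b q K Φ) {f u : ℝ → ℝ} (c : ℝ) (hu : Sol b q K Φ f u) :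
    Sol b q K Φ (c • f) (c • u) := by
  refine ⟨hu.ll.smul c, fun s hs => by simp [hu.hist s hs], ?_, fun t ht => ?_⟩
  · obtain ⟨C, hC⟩ := hu.growth
    refine ⟨|c| * C, fun s hs => ?_⟩
    rw [Pi.smul_apply, smul_eq_mul, abs_mul, mul_assoc]
    exact mul_le_mul_of_nonneg_left (hC s hs) (abs_nonneg c)
  · have := H.smul c _ ((hu.ll.shift t).memLpLoc H.hq b)
    simp only [Pi.smul_apply, smul_eq_mul]
    rw [hu.eqn t ht, ← this]
    rfl

lemma Sol.shift {f u : ℝ → ℝ} (hu : Sol b q K Φ f u) {s : ℝ} (hs : 0 ≤ s) :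
    Sol b q K Φ (fun r => u (r + s)) (fun r => u (r + s)) := by
  refine ⟨hu.ll.shift s, fun _ _ => rfl, ?_, fun t ht => ?_⟩
  · obtain ⟨C, hC⟩ := hu.growth
    refine ⟨C * Real.exp (lam q K * s), fun r hr => ?_⟩
    refine (hC (r + s) (by linarith)).trans (le_of_eq ?_)
    rw [mul_assoc, ← Real.exp_add]
    ring_nf
  · have := hu.eqn (t + s) (by linarith)
    simpa only [add_assoc] using this

lemma Sol.ae_unique (H : Hyp b q K Φ) {f g u v : ℝ → ℝ} (hf : MemLpLoc b q f)
    (hg : MemLpLoc b q g) (hu : Sol b q K Φ f u) (hv : Sol b q K Φ g v)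
    (hfg : f =ᵐ[volume.restrict (Iic b)] g) : u =ᵐ[volume] v := by
  have hd := hu.add H (hv.smul H (-1))
  have hfd := memLpLoc_add H.hq hf (memLpLoc_smul H.hq (-1) hg)
  have hz : locLpSeminorm b q 1 (f + (-1 : ℝ) • g) = 0 := by
    have : f + (-1 : ℝ) • g =ᵐ[volume.restrict (Iic b)] (0 : ℝ → ℝ) := by
      filter_upwards [hfg] with s hs
      simp [hs]
    rw [seminorm_eq' H.hq hfd, eLpNorm_congr_ae
      (ae_restrict_of_ae_restrict_of_subset Icc_subset_Iic_self this)]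
    simp
  have h1 := (ae_restrict_iff' measurableSet_Iic).1 hfg
  filter_upwards [h1] with s hs
  rcases le_or_gt s b with h | h
  · rw [hu.hist s h, hv.hist s h, hs h]
  · have := hd.bound H hfd h
    rw [hz] at this
    simp at this
    linarith

lemma ae_shift {u v : ℝ → ℝ} (h : u =ᵐ[volume] v) (t : ℝ) (A : Set ℝ) :
    (fun s => u (s + t)) =ᵐ[volume.restrict A] (fun s => v (s + t)) :=
  ae_restrict_of_ae
    ((measurePreserving_add_right (volume : Measure ℝ) t).quasiMeasurePreserving.ae_eq_comp h)

open Classical in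
/-- The solution of the renewal equation. -/
noncomputable def usol (b q K : ℝ) (Φ : (ℝ → ℝ) → ℝ) (f : ℝ → ℝ) : ℝ → ℝ :=
  if h : ∃ u, Sol b q K Φ f u then h.choose else 0

lemma usol_sol (H : Hyp b q K Φ) {f : ℝ → ℝ} (hf : MemLpLoc b q f) :
    Sol b q K Φ f (usol b q K Φ f) := by
  have h := Sol.exists H hf
  rw [usol, dif_pos h]
  exact h.choose_spec

lemma tendsto_seminorm {l : Filter ℝ} (hq : 1 < q) {n : ℕ} {F : ℝ → ℝ → ℝ}
    (hF : ∀ t, LL q (F t))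
    (h : Tendsto (fun t => eLpNorm (F t) (ENNReal.ofReal q)
      (volume.restrict (Icc (-(n : ℝ)) b))) l (𝓝 0)) :
    Tendsto (fun t => locLpSeminorm b q n (F t)) l (𝓝 0) := by
  have h' := (ENNReal.tendsto_toReal ENNReal.zero_ne_top).comp h
  refine h'.congr fun t => ?_
  rw [seminorm_eq hq ((hF t).2 _ _)]
  rfl

lemma equicont (H : Hyp b q K Φ) (t₀ : ℝ) (n : ℕ) : ∃ m : ℕ, ∃ M : ℝ, 0 ≤ M ∧
    ∀ f : ℝ → ℝ, MemLpLoc b q f → ∀ t ∈ Icc (0 : ℝ) t₀,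
      locLpSeminorm b q n (fun s => usol b q K Φ f (s + t)) ≤ M * locLpSeminorm b q m f := by
  have hK := H.hK
  have hl := H.lam_pos
  set A : ℝ := (volume.restrict (Icc (-(n : ℝ)) b) univ ^ (ENNReal.ofReal q).toReal⁻¹).toReal
    with hA
  have hA0 : 0 ≤ A := ENNReal.toReal_nonneg
  refine ⟨n + 1, 1 + A * (2 * K * Real.exp (lam q K * t₀)), by positivity, ?_⟩
  intro f hf t ht
  have hu := usol_sol H hf
  set u := usol b q K Φ f
  have h1 := hu.ll.indicator (measurableSet_Iic (a := b))
  have h2 := hu.ll.indicator (measurableSet_Ioi (a := b))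
  have hp := seminorm_nonneg b q 1 f
  have e : (fun s => u (s + t)) = (fun s => (Iic b).indicator u (s + t)) +
      (fun s => (Ioi b).indicator u (s + t)) := by
    ext s; exact congrFun (split b u) (s + t)
  rw [e]
  refine (seminorm_add_le H.hq (h1.shift t) (h2.shift t) n).trans ?_
  have e1 := seminorm_head H.hq hu.ll hf hu.hist ht.1 n
  have e2 := seminorm_mono H.hq hf (Nat.le_succ n)
  have e3 : locLpSeminorm b q 1 f ≤ locLpSeminorm b q (n + 1) f :=
    seminorm_mono H.hq hf (by omega)
  set C := 2 * K * locLpSeminorm b q 1 f * Real.exp (lam q K * t₀) with hC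
  have hC0 : 0 ≤ C := by positivity
  have e4 : locLpSeminorm b q n (fun s => (Ioi b).indicator u (s + t)) ≤ A * C := by
    rw [seminorm_eq H.hq ((h2.shift t).2 _ _)]
    have hb := eLpNorm_le_of_ae_bound (p := ENNReal.ofReal q)
      (μ := volume.restrict (Icc (-(n : ℝ)) b)) (f := fun s => (Ioi b).indicator u (s + t))
      (C := C) ((ae_restrict_iff' measurableSet_Icc).2 (Eventually.of_forall fun s hs => by
        have := tail_bound (b := b) (u := u) (l := lam q K)
          (C := 2 * K * locLpSeminorm b q 1 f) (by positivity) (fun s hs => hu.bound H hf hs)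
          (s + t)
        rw [Real.norm_eq_abs]
        refine this.trans ?_
        rw [hC]
        gcongr
        linarith [hs.2, ht.2]))
    refine (ENNReal.toReal_mono ?_ hb).trans (le_of_eq ?_)
    · refine ENNReal.mul_ne_top (ENNReal.rpow_ne_top_of_nonneg (by positivity) ?_)
        ENNReal.ofReal_ne_top
      simp
    · rw [ENNReal.toReal_mul, ENNReal.toReal_ofReal hC0]
  calc _ ≤ locLpSeminorm b q (n + 1) f +
        A * (2 * K * locLpSeminorm b q (n + 1) f * Real.exp (lam q K * t₀)) := by
        refine add_le_add (e1.trans e2) (e4.trans ?_)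
        rw [hC]; gcongr
    _ = _ := by ring

lemma Phi_diffq (H : Hyp b q K Φ) {D Y : ℝ → ℝ} (hD : LL q D) (hYL : LL q Y)
    (hY : ∀ s t, Y t - Y s = ∫ r in s..t, D r) :
    Tendsto (fun h => h⁻¹ * (Φ (fun s => Y (s + h)) - Φ Y)) (𝓝[>] 0) (𝓝 (Φ D)) := by
  have hL : ∀ h : ℝ, LL q (h⁻¹ • ((fun s => Y (s + h)) - Y) - D) := fun h =>
    (((hYL.shift h).sub hYL).smul _).sub hD
  have h1 := tendsto_seminorm (b := b) (n := 1) H.hq hL (tendsto_diffq H.hq hD hY _ b)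
  have h2 := h1.const_mul K
  rw [mul_zero] at h2
  rw [tendsto_iff_dist_tendsto_zero]
  refine squeeze_zero (fun _ => dist_nonneg) (fun h => ?_) h2
  have := H.bound _ ((hL h).memLpLoc H.hq b)
  rw [H.sub (((hYL.shift h).sub hYL).smul _) hD,
    H.smul _ _ (((hYL.shift h).sub hYL).memLpLoc H.hq b), H.sub (hYL.shift h) hYL] at this
  exact this

/-- On the right of `b`, a primitive of the solution is a primitive of a continuous function. -/
lemma Sol.integral_eq {f u : ℝ → ℝ} (hu : Sol b q K Φ f u) {t : ℝ}
    (ht : 0 ≤ t) : ∫ r in b..(b + t), u r = ∫ r in (0 : ℝ)..t, Φ (fun s => u (s + r)) := by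
  have := intervalIntegral.integral_comp_add_left (a := 0) (b := t) u b
  rw [add_zero] at this
  rw [← this, intervalIntegral.integral_of_le ht, intervalIntegral.integral_of_le ht]
  exact setIntegral_congr_fun measurableSet_Ioc fun r hr => hu.eqn r hr.1

lemma primitive_sol (H : Hyp b q K Φ) {d U Y : ℝ → ℝ}
    (hU : Sol b q K Φ d U) (hY : ∀ s t, Y t - Y s = ∫ r in s..t, U r) (hYc : Continuous Y)
    (hYb : Y b = Φ Y) : Sol b q K Φ Y Y := by
  have hYL : LL q Y := LL.of_continuous hYc
  have hl := H.lam_pos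
  refine ⟨hYL, fun _ _ => rfl, ?_, fun t ht => ?_⟩
  · obtain ⟨C, hC⟩ := hU.growth
    refine ⟨|Y b| + |C| / lam q K, fun s hs => ?_⟩
    have h1 : Y s = Y b + ∫ r in b..s, U r := by rw [← hY]; ring
    have h2 : ‖∫ r in b..s, U r‖ ≤ ∫ r in b..s, |C| * Real.exp (lam q K * (r - b)) := by
      refine intervalIntegral.norm_integral_le_of_norm_le hs.le
        (Eventually.of_forall fun r hr => ?_)
        (Continuous.intervalIntegrable (by fun_prop) _ _)
      refine (hC r hr.1).trans ?_
      gcongr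
      exact le_abs_self C
    have h3 : ∫ r in b..s, |C| * Real.exp (lam q K * (r - b)) ≤
        |C| / lam q K * Real.exp (lam q K * (s - b)) := by
      rw [intervalIntegral.integral_eq_sub_of_hasDerivAt
        (f := fun s => |C| / lam q K * Real.exp (lam q K * (s - b)))]
      · simp; positivity
      · intro x _
        have := ((((hasDerivAt_id x).sub_const b).const_mul (lam q K)).exp).const_mul
          (|C| / lam q K)
        convert! this using 1
        field_simp; simp
      · exact (Continuous.intervalIntegrable (by fun_prop) _ _)
    rw [h1, add_mul]
    refine (abs_add_le _ _).trans (add_le_add ?_ (h2.trans h3))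
    exact le_mul_of_one_le_right (abs_nonneg _)
      (Real.one_le_exp (mul_nonneg hl.le (by linarith)))
  · have hc := continuous_Phi H hU.ll
    have key := eq_of_has_deriv_right_eq (a := 0) (b := t)
      (f := fun z => Y b + ∫ r in (0 : ℝ)..z, Φ (fun s => U (s + r)))
      (g := fun z => Φ (fun s => Y (s + z)))
      (f' := fun z => Φ (fun s => U (s + z)))
      (fun z _ => ((intervalIntegral.integral_hasDerivAt_right (hc.intervalIntegrable _ _)
        hc.stronglyMeasurable.stronglyMeasurableAtFilter
        hc.continuousAt).const_add (Y b)).hasDerivWithinAt)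
      (fun z _ => by
        rw [← hasDerivWithinAt_Ioi_iff_Ici, hasDerivWithinAt_iff_tendsto_slope' (by simp)]
        have hY' : ∀ s t, Y (t + z) - Y (s + z) = ∫ r in s..t, U (r + z) := fun s t => by
          rw [hY, intervalIntegral.integral_comp_add_right]
        have h1 := Phi_diffq H (hU.ll.shift z) (hYL.shift z) hY'
        have h2 : Tendsto (fun w => w - z) (𝓝[>] z) (𝓝[>] 0) := by
          refine tendsto_nhdsWithin_iff.2 ⟨?_, ?_⟩
          · have : Tendsto (fun w => w - z) (𝓝 z) (𝓝 (z - z)) :=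
              (continuous_id.sub continuous_const).continuousAt
            rw [sub_self] at this
            exact this.mono_left nhdsWithin_le_nhds
          · filter_upwards [self_mem_nhdsWithin] with w hw
            simpa using hw
        refine (h1.comp h2).congr fun w => ?_
        simp only [Function.comp, slope_def_field]
        have : (fun s => Y (s + (w - z) + z)) = fun s => Y (s + w) := by
          ext s; congr 1; ring
        rw [this]
        ring)
      (Continuous.continuousOn (continuous_const.add
        (intervalIntegral.continuous_primitive (fun _ _ => hc.intervalIntegrable _ _) _)))
      (continuous_Phi H hYL).continuousOn
      (by simpa using hYb) t ⟨ht.le, le_rfl⟩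
    rw [← key]
    rw [← hU.integral_eq ht.le, ← hY]
    ring

lemma gen1 (H : Hyp b q K Φ) (x y d : ℝ → ℝ) (hx : MemLpLoc b q x) (hd : MemLpLoc b q d)
    (hxy : x =ᵐ[volume.restrict (Iic b)] y)
    (hyd : ∀ s t : ℝ, s ≤ t → t ≤ b → y t - y s = ∫ r in s..t, d r)
    (hyb : y b = Φ x) (n : ℕ) :
    Tendsto (fun h : ℝ => locLpSeminorm b q n
      (fun s : ℝ => h⁻¹ * (usol b q K Φ x (s + h) - x s) - d s)) (𝓝[>] (0 : ℝ)) (𝓝 0) := by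
  have hU := usol_sol H hd
  set U := usol b q K Φ d
  have hUi := hU.ll.intervalIntegrable H.hq
  let Y : ℝ → ℝ := fun s => y b + ∫ r in b..s, U r
  have hY : ∀ s t, Y t - Y s = ∫ r in s..t, U r := fun s t => by
    simp only [Y]
    rw [← intervalIntegral.integral_interval_sub_left (hUi b t) (hUi b s)]
    ring
  have hYc : Continuous Y := continuous_const.add
    (intervalIntegral.continuous_primitive (fun _ _ => hUi _ _) _)
  have hYL : LL q Y := LL.of_continuous hYc
  have hYy : ∀ s ≤ b, y s = Y s := fun s hs => by
    have h1 := hyd s b hs le_rfl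
    have h2 := hY s b
    have h3 : ∫ r in s..b, d r = ∫ r in s..b, U r := by
      refine intervalIntegral.integral_congr fun r hr => ?_
      rw [uIcc_of_le hs] at hr
      exact (hU.hist r hr.2).symm
    have h4 : Y b = y b := by simp [Y]
    linarith
  have hxY : x =ᵐ[volume.restrict (Iic b)] Y := by
    filter_upwards [hxy, ae_restrict_mem measurableSet_Iic] with s h1 h2
    rw [h1, hYy s h2]
  have hYm := hYL.memLpLoc H.hq b
  have hYs := primitive_sol H hU hY hYc (by rw [← H.ae x Y hx hYm hxY, ← hyb, hYy b le_rfl])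
  have hxu := (usol_sol H hx).ae_unique H hx hYm hYs hxY
  have hL : ∀ h : ℝ, LL q (fun s => h⁻¹ * (Y (s + h) - Y s) - U s) := fun h =>
    (((hYL.shift h).sub hYL).smul h⁻¹).sub hU.ll
  refine (tendsto_seminorm (b := b) (n := n) H.hq hL (tendsto_diffq H.hq hU.ll hY _ b)).congr
    fun h => ?_
  refine seminorm_congr ?_ n
  filter_upwards [hxY, ae_restrict_mem measurableSet_Iic, ae_shift hxu h (Iic b)] with s h1 h2 h3
  rw [h1, h3, hU.hist s h2]

lemma gen2 (H : Hyp b q K Φ) (x g : ℝ → ℝ) (hx : MemLpLoc b q x) (hg : MemLpLoc b q g)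
    (hlim : ∀ n : ℕ, Tendsto (fun h : ℝ => locLpSeminorm b q n
      (fun s : ℝ => h⁻¹ * (usol b q K Φ x (s + h) - x s) - g s)) (𝓝[>] (0 : ℝ)) (𝓝 0)) :
    ∃ y : ℝ → ℝ, x =ᵐ[volume.restrict (Iic b)] y ∧
      (∀ s t : ℝ, s ≤ t → t ≤ b → y t - y s = ∫ r in s..t, g r) ∧ y b = Φ x := by
  have hu := usol_sol H hx
  set u := usol b q K Φ x
  have hui := hu.ll.intervalIntegrable H.hq
  have hG := LL_indicator_Iic H.hq hg
  set G := (Iic b).indicator g with hGdef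
  have hGi := hG.intervalIntegrable H.hq
  have hGg : ∀ s t, s ≤ b → t ≤ b → ∫ r in s..t, G r = ∫ r in s..t, g r := fun s t hs ht => by
    refine intervalIntegral.integral_congr fun r hr => ?_
    have : r ≤ b := hr.2.trans (max_le hs ht)
    simp [G, this]
  have hΦx : Φ (fun s => u (s + 0)) = Φ x := by
    refine H.ae _ _ ((hu.ll.shift 0).memLpLoc H.hq b) hx ?_
    filter_upwards [ae_restrict_mem measurableSet_Iic] with s hs
    rw [add_zero, hu.hist s hs]
  refine ⟨fun s => Φ x - ∫ r in s..b, g r, ?_, ?_, by simp⟩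
  · have hL := _root_.LocallyIntegrable.ae_hasDerivAt_integral (hu.ll.locallyIntegrable H.hq)
    rw [EventuallyEq, ae_restrict_iff' measurableSet_Iic]
    filter_upwards [hL] with a ha hab
    have hab : a ≤ b := hab
    rw [← hu.hist a hab]
    have hLF : ∀ h : ℝ, LL q (fun s => h⁻¹ * (u (s + h) - u s) - G s) := fun h =>
      (((hu.ll.shift h).sub hu.ll).smul h⁻¹).sub hG
    -- the integrals converge
    have c1 : Tendsto (fun h : ℝ => ∫ s in a..b, (h⁻¹ * (u (s + h) - u s) - G s))
        (𝓝[>] 0) (𝓝 0) := by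
      obtain ⟨n, hn⟩ := exists_nat_gt (-a)
      set μ := volume.restrict (Icc (-(n : ℝ)) b) with hμ
      set A : ℝ := (μ univ ^ (1 / (1 : ℝ≥0∞).toReal - 1 / (ENNReal.ofReal q).toReal)).toReal
      have h1 := (hlim n).mul_const A
      rw [zero_mul] at h1
      refine squeeze_zero_norm (fun h => ?_) h1
      have hLh := hLF h
      have e1 : locLpSeminorm b q n (fun s : ℝ => h⁻¹ * (u (s + h) - x s) - g s) =
          (eLpNorm (fun s => h⁻¹ * (u (s + h) - u s) - G s) (ENNReal.ofReal q) μ).toReal := by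
        rw [← seminorm_eq H.hq (hLh.2 _ _)]
        refine seminorm_congr ?_ n
        filter_upwards [ae_restrict_mem measurableSet_Iic] with s hs
        rw [hu.hist s hs, hGdef, indicator_of_mem hs]
      rw [e1]
      have hfin : μ univ ^ (1 / (1 : ℝ≥0∞).toReal - 1 / (ENNReal.ofReal q).toReal) ≠ ⊤ := by
        refine ENNReal.rpow_ne_top_of_nonneg ?_ (by simp [hμ])
        have hq := H.hq
        rw [ENNReal.toReal_ofReal (by linarith)]
        have : 1 / q ≤ 1 := by rw [div_le_one (by linarith)]; exact hq.le
        simpa using this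
      rw [← ENNReal.toReal_mul]
      have e2 := eLpNorm_le_eLpNorm_mul_rpow_measure_univ (μ := μ) (p := 1)
        (q := ENNReal.ofReal q) (by simpa using H.hq.le) (hLh.1.restrict (s := Icc (-(n : ℝ)) b))
      refine le_trans ?_ (ENNReal.toReal_mono (ENNReal.mul_ne_top (hLh.2 _ _).2.ne hfin) e2)
      rw [eLpNorm_one_eq_lintegral_enorm, ← integral_norm_eq_lintegral_enorm hLh.1.restrict]
      refine (intervalIntegral.norm_integral_le_integral_norm hab).trans ?_
      rw [intervalIntegral.integral_of_le hab]
      refine setIntegral_mono_set (hLh.integrableOn H.hq _ _).norm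
        (Eventually.of_forall fun _ => norm_nonneg _) (HasSubset.Subset.eventuallyLE ?_)
      exact fun r hr => ⟨by linarith [hr.1], hr.2⟩
    -- the limit computed directly
    have c2 : Tendsto (fun h : ℝ => ∫ s in a..b, (h⁻¹ * (u (s + h) - u s) - G s))
        (𝓝[>] 0) (𝓝 (Φ x - u a - ∫ r in a..b, G r)) := by
      have hc := continuous_Phi H hu.ll
      have d1 : HasDerivAt (fun z => ∫ r in (0 : ℝ)..z, Φ (fun s => u (s + r))) (Φ x) 0 := by
        rw [← hΦx]
        exact intervalIntegral.integral_hasDerivAt_right (hc.intervalIntegrable _ _)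
          hc.stronglyMeasurable.stronglyMeasurableAtFilter hc.continuousAt
      have t1 := d1.tendsto_slope_zero_right
      have t2 := (ha a).tendsto_slope_zero_right
      refine ((t1.sub t2).sub_const (∫ r in a..b, G r)).congr' ?_
      filter_upwards [self_mem_nhdsWithin] with h hh
      have hh : 0 < h := hh
      have hus := (hu.ll.shift h).intervalIntegrable H.hq a b
      rw [intervalIntegral.integral_sub ((hus.sub (hui a b)).const_mul _) (hGi a b),
        intervalIntegral.integral_const_mul, intervalIntegral.integral_sub hus (hui a b),
        intervalIntegral.integral_comp_add_right]
      simp only [zero_add, intervalIntegral.integral_same, sub_zero, smul_eq_mul]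
      rw [← hu.integral_eq hh.le]
      have s1 := intervalIntegral.integral_add_adjacent_intervals (hui a (a + h))
        (hui (a + h) (b + h))
      have s2 := intervalIntegral.integral_add_adjacent_intervals (hui a b) (hui b (b + h))
      rw [← mul_sub]
      congr 2
      linarith
    have := tendsto_nhds_unique c1 c2
    rw [hGg a b hab le_rfl] at this
    linarith
  · intro s t hst htb
    have h := intervalIntegral.integral_add_adjacent_intervals (hGi s t) (hGi t b)
    rw [hGg s t (hst.trans htb) htb, hGg t b htb le_rfl, hGg s b (hst.trans htb) le_rfl] at h
    linarith

end

end DSAux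

/-- The **Example**: on the Fréchet space `X = L^p_loc((-∞,b])` (with seminorms
`p_n(x) = (∫_{-n}^b |x|^p)^{1/p}`, here expressed on representatives via `locLpSeminorm`),
given a continuous linear functional `Φ` with `|Φ x| ≤ K p₁(x)`, the operator `C x = x'`
with domain `D(C) = {x ∈ W^{1,p}_loc((-∞,b]) : x(b) = Φ(x)}` generates a locally
equicontinuous `C₀`-semigroup on `X`.  The semigroup `S` is given at the level of
representative functions (respecting a.e. equality on `(-∞,b]`, which encodes
well-definedness on `X`), the topology of `X` is expressed through the seminorms, and
membership of `x` in `D(C)` is expressed by the existence of a representative `y` which is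
an indefinite integral of a function `d ∈ L^p_loc` (so `C x = x' = d`) with
`y b = Φ x`. -/
theorem example_boundary_perturbation_generates
    (b : ℝ) (hb : 0 < b) (q : ℝ) (hq : 1 < q) (K : ℝ) (hK : 0 < K)
    (Φ : (ℝ → ℝ) → ℝ)
    (hΦae : ∀ f g : ℝ → ℝ, MemLpLoc b q f → MemLpLoc b q g →
      f =ᵐ[volume.restrict (Iic b)] g → Φ f = Φ g)
    (hΦadd : ∀ f g : ℝ → ℝ, MemLpLoc b q f → MemLpLoc b q g → Φ (f + g) = Φ f + Φ g)
    (hΦsmul : ∀ (c : ℝ) (f : ℝ → ℝ), MemLpLoc b q f → Φ (c • f) = c * Φ f)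
    (hΦbound : ∀ f : ℝ → ℝ, MemLpLoc b q f → |Φ f| ≤ K * locLpSeminorm b q 1 f) :
    ∃ S : ℝ → (ℝ → ℝ) → ℝ → ℝ,
      -- `S t` maps `X` into `X` ...
      (∀ t : ℝ, 0 ≤ t → ∀ f : ℝ → ℝ, MemLpLoc b q f → MemLpLoc b q (S t f)) ∧
      -- ... respects a.e. equality (well-definedness on equivalence classes) ...
      (∀ t : ℝ, 0 ≤ t → ∀ f g : ℝ → ℝ, MemLpLoc b q f → MemLpLoc b q g →
        f =ᵐ[volume.restrict (Iic b)] g →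
        S t f =ᵐ[volume.restrict (Iic b)] S t g) ∧
      -- ... and is linear
      (∀ t : ℝ, 0 ≤ t → ∀ f g : ℝ → ℝ, MemLpLoc b q f → MemLpLoc b q g →
        S t (f + g) =ᵐ[volume.restrict (Iic b)] S t f + S t g) ∧
      (∀ t : ℝ, 0 ≤ t → ∀ (c : ℝ) (f : ℝ → ℝ), MemLpLoc b q f →
        S t (c • f) =ᵐ[volume.restrict (Iic b)] c • S t f) ∧
      -- semigroup laws
      (∀ f : ℝ → ℝ, MemLpLoc b q f → S 0 f =ᵐ[volume.restrict (Iic b)] f) ∧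
      (∀ t s : ℝ, 0 ≤ t → 0 ≤ s → ∀ f : ℝ → ℝ, MemLpLoc b q f →
        S (t + s) f =ᵐ[volume.restrict (Iic b)] S t (S s f)) ∧
      -- strong continuity, in the seminorm topology of `X`
      (∀ f : ℝ → ℝ, MemLpLoc b q f → ∀ r₀ : ℝ, 0 ≤ r₀ → ∀ n : ℕ,
        Tendsto (fun t : ℝ => locLpSeminorm b q n (S t f - S r₀ f))
          (𝓝[Ici (0 : ℝ)] r₀) (𝓝 0)) ∧
      -- local equicontinuity
      (∀ t₀ : ℝ, 0 < t₀ → ∀ n : ℕ, ∃ m : ℕ, ∃ M : ℝ, 0 ≤ M ∧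
        ∀ f : ℝ → ℝ, MemLpLoc b q f → ∀ t ∈ Icc (0 : ℝ) t₀,
          locLpSeminorm b q n (S t f) ≤ M * locLpSeminorm b q m f) ∧
      -- the generator is `C`, part 1: `D(C)` is contained in the domain of the
      -- generator, with value `C x = x' = d`
      (∀ x y d : ℝ → ℝ, MemLpLoc b q x → MemLpLoc b q d →
        x =ᵐ[volume.restrict (Iic b)] y →
        (∀ s t : ℝ, s ≤ t → t ≤ b → y t - y s = ∫ r in s..t, d r) →
        y b = Φ x →
        ∀ n : ℕ, Tendsto (fun h : ℝ =>
            locLpSeminorm b q n (fun s : ℝ => h⁻¹ * (S h x s - x s) - d s))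
          (𝓝[>] (0 : ℝ)) (𝓝 0)) ∧
      -- the generator is `C`, part 2: the domain of the generator is contained in `D(C)`
      (∀ x g : ℝ → ℝ, MemLpLoc b q x → MemLpLoc b q g →
        (∀ n : ℕ, Tendsto (fun h : ℝ =>
            locLpSeminorm b q n (fun s : ℝ => h⁻¹ * (S h x s - x s) - g s))
          (𝓝[>] (0 : ℝ)) (𝓝 0)) →
        ∃ y : ℝ → ℝ, x =ᵐ[volume.restrict (Iic b)] y ∧
          (∀ s t : ℝ, s ≤ t → t ≤ b → y t - y s = ∫ r in s..t, g r) ∧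
          y b = Φ x) := by
  have H : DSAux.Hyp b q K Φ := ⟨hb, hq, hK, hΦae, hΦadd, hΦsmul, hΦbound⟩
  refine ⟨fun t f s => DSAux.usol b q K Φ f (s + t), ?_, ?_, ?_, ?_, ?_, ?_, ?_, ?_, ?_, ?_⟩
  · intro t ht f hf
    exact ((DSAux.usol_sol H hf).ll.shift t).memLpLoc hq b
  · intro t ht f g hf hg hfg
    exact DSAux.ae_shift
      ((DSAux.usol_sol H hf).ae_unique H hf hg (DSAux.usol_sol H hg) hfg) t _
  · intro t ht f g hf hg
    have hfg := DSAux.memLpLoc_add hq hf hg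
    exact DSAux.ae_shift ((DSAux.usol_sol H hfg).ae_unique H hfg hfg
      ((DSAux.usol_sol H hf).add H (DSAux.usol_sol H hg)) EventuallyEq.rfl) t _
  · intro t ht c f hf
    have hcf := DSAux.memLpLoc_smul hq c hf
    exact DSAux.ae_shift ((DSAux.usol_sol H hcf).ae_unique H hcf hcf
      ((DSAux.usol_sol H hf).smul H c) EventuallyEq.rfl) t _
  · intro f hf
    filter_upwards [ae_restrict_mem measurableSet_Iic] with s hs
    rw [add_zero, (DSAux.usol_sol H hf).hist s hs]
  · intro t s ht hs f hf
    have hu := DSAux.usol_sol H hf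
    have hm := (hu.ll.shift s).memLpLoc hq b
    have h := DSAux.ae_shift ((hu.shift hs).ae_unique H hm hm (DSAux.usol_sol H hm)
      EventuallyEq.rfl) t (Iic b)
    simpa only [add_assoc] using h
  · intro f hf r₀ hr₀ n
    have hu := DSAux.usol_sol H hf
    exact DSAux.tendsto_seminorm hq (fun t => (hu.ll.shift t).sub (hu.ll.shift r₀))
      ((hu.ll.tendsto_shift hq _ b r₀).mono_left nhdsWithin_le_nhds)
  · intro t₀ _ n
    exact DSAux.equicont H t₀ n
  · intro x y d hx hd hxy hyd hyb n
    exact DSAux.gen1 H x y d hx hd hxy hyd hyb n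
  · intro x g hx hg hlim
    exact DSAux.gen2 H x g hx hg hlim
end
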